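/- arXiv:2503.12223 — 3 statements merged into one kernel-verified Lean document; each statement's English description precedes it below -/
import Mathlib

section
/- Let P1 be a finite poset with the unique cover twin property and at least 2 elements, and let P2 be any finite poset. Then the induced saturation number sat*(n, P2 * • * P1) tends to infinity as n tends to infinity, where • denotes the one-element poset. -/
open Finset Filter

/-- An induced copy of the poset `α` inside the family `𝒜` of subsets of `Fin n`
(representing `[n] = {1,…,n}`): an injective map `f : α → Finset (Fin n)` with image
contained in `𝒜` such that `a ≤ b ↔ f a ⊆ f b`. -/
def IsInducedCopy {α : Type*} [PartialOrder α] {n : ℕ}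
    (𝒜 : Finset (Finset (Fin n))) (f : α → Finset (Fin n)) : Prop :=
  Function.Injective f ∧ (∀ a, f a ∈ 𝒜) ∧ ∀ a b : α, a ≤ b ↔ f a ⊆ f b

/-- The family `𝒜` contains an induced copy of the poset `α`. -/
def ContainsCopy (α : Type*) [PartialOrder α] {n : ℕ}
    (𝒜 : Finset (Finset (Fin n))) : Prop :=
  ∃ f : α → Finset (Fin n), IsInducedCopy 𝒜 f

/-- `𝒜` is an `α`-saturated family: it contains no induced copy of `α`, but adding any
set not in `𝒜` creates an induced copy of `α`. -/
def IsSaturatedFamily (α : Type*) [PartialOrder α] {n : ℕ}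
    (𝒜 : Finset (Finset (Fin n))) : Prop :=
  ¬ ContainsCopy α 𝒜 ∧
    ∀ S : Finset (Fin n), S ∉ 𝒜 → ContainsCopy α (insert S 𝒜)

/-- The induced saturation number `sat*(n, α)`: the minimum size of an `α`-saturated
family of subsets of `[n]`. -/
noncomputable def satStar (α : Type*) [PartialOrder α] (n : ℕ) : ℕ :=
  sInf {k : ℕ | ∃ 𝒜 : Finset (Finset (Fin n)), IsSaturatedFamily α 𝒜 ∧ 𝒜.card = k}

/-- The unique cover twin property (UCTP): whenever `p2` covers `p1`, there exists an
element comparable with exactly one of `p1` and `p2`. -/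
def UCTP (α : Type*) [PartialOrder α] : Prop :=
  ∀ p1 p2 : α, p1 ⋖ p2 →
    ∃ p3 : α, Xor' (p3 ≤ p1 ∨ p1 ≤ p3) (p3 ≤ p2 ∨ p2 ≤ p3)

theorem IsInducedCopy.ssubset {α : Type*} [PartialOrder α] {n : ℕ}
    {𝒜 : Finset (Finset (Fin n))} {f : α → Finset (Fin n)} (hf : IsInducedCopy 𝒜 f)
    {a b : α} (h : a < b) : f a ⊂ f b :=
  Finset.ssubset_def.2 ⟨(hf.2.2 a b).1 h.le, fun hba => h.not_ge ((hf.2.2 b a).2 hba)⟩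

/-- Copies of `P1` and `P2` in `𝒜`, separated by a member of `𝒜`, form a copy of the glued
poset. -/
theorem containsCopy_glue {P1 P2 : Type*} [PartialOrder P1] [PartialOrder P2] {n : ℕ}
    {𝒜 : Finset (Finset (Fin n))} {f₁ : P1 → Finset (Fin n)} {X : Finset (Fin n)}
    {f₂ : P2 → Finset (Fin n)} (hf₁ : ∀ p, f₁ p ∈ 𝒜) (hX : X ∈ 𝒜) (hf₂ : ∀ q, f₂ q ∈ 𝒜)
    (hle₁ : ∀ a b, a ≤ b ↔ f₁ a ⊆ f₁ b) (hle₂ : ∀ a b, a ≤ b ↔ f₂ a ⊆ f₂ b)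
    (h₁X : ∀ p, f₁ p ⊂ X) (hX₂ : ∀ q, X ⊂ f₂ q) :
    ContainsCopy (P1 ⊕ₗ Unit ⊕ₗ P2) 𝒜 := by
  let f : P1 ⊕ₗ Unit ⊕ₗ P2 → Finset (Fin n) := fun z =>
    Sum.elim f₁ (fun w => Sum.elim (fun _ => X) f₂ (ofLex w)) (ofLex z)
  have hle : ∀ a b, a ≤ b ↔ f a ⊆ f b := by
    have hl : ∀ p, f (Sum.inlₗ p) = f₁ p := fun _ => rfl
    have hm : f (Sum.inrₗ (Sum.inlₗ ())) = X := rfl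
    have hr : ∀ q, f (Sum.inrₗ (Sum.inrₗ q)) = f₂ q := fun _ => rfl
    have h₁₂ : ∀ p q, f₁ p ⊂ f₂ q := fun p q => (h₁X p).trans (hX₂ q)
    rintro (a | ⟨⟨⟩⟩ | a) (b | ⟨⟨⟩⟩ | b)
    · exact Sum.Lex.inl_le_inl_iff.trans (hle₁ a b)
    · exact iff_of_true (Sum.Lex.inl_le_inr _ _) (h₁X a).1
    · exact iff_of_true (Sum.Lex.inl_le_inr _ _) (h₁₂ a b).1
    · exact iff_of_false Sum.Lex.not_inr_le_inl (h₁X b).2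
    · exact iff_of_true le_rfl subset_rfl
    · exact iff_of_true (Sum.Lex.inr_le_inr_iff.2 (Sum.Lex.inl_le_inr _ _)) (hX₂ b).1
    · exact iff_of_false Sum.Lex.not_inr_le_inl (h₁₂ b a).2
    · exact iff_of_false (fun h => Sum.Lex.not_inr_le_inl (Sum.Lex.inr_le_inr_iff.1 h)) (hX₂ a).2
    · exact (Sum.Lex.inr_le_inr_iff.trans Sum.Lex.inr_le_inr_iff).trans (hle₂ a b)
  refine ⟨f, fun a b h => le_antisymm ((hle a b).2 h.subset) ((hle b a).2 h.symm.subset), ?_, hle⟩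
  rintro (a | ⟨⟨⟩⟩ | a)
  exacts [hf₁ a, hX, hf₂ a]

/-- If `𝒜` is saturated and does not separate `i` from `j`, then removing `i` from a minimal
member `A` of `𝒜` containing `i` creates a copy in which `A.erase i` and `A` play the roles of
two elements, one covering the other, with the same comparable elements. -/
theorem IsSaturatedFamily.exists_cover_twins {α : Type*} [PartialOrder α] {n : ℕ}
    {𝒜 : Finset (Finset (Fin n))} (h𝒜 : IsSaturatedFamily α 𝒜) {i j : Fin n} (hij : i ≠ j)
    (hsep : ∀ B ∈ 𝒜, i ∈ B ↔ j ∈ B) {A : Finset (Fin n)} (hA : A ∈ 𝒜) (hiA : i ∈ A)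
    (hmin : ∀ B ∈ 𝒜, i ∈ B → B ⊆ A → B = A) :
    ∃ (g : α → Finset (Fin n)) (a b : α), IsInducedCopy (insert (A.erase i) 𝒜) g ∧
      g a = A.erase i ∧ g b = A ∧ (∀ r, r ≠ a → g r ∈ 𝒜) ∧ a ⋖ b ∧
      ∀ r, (r ≤ a ∨ a ≤ r) ↔ (r ≤ b ∨ b ≤ r) := by
  set S := A.erase i with hS
  have hjS : j ∈ S := Finset.mem_erase.2 ⟨hij.symm, (hsep A hA).1 hiA⟩
  have hiS : i ∉ S := Finset.notMem_erase i A
  have hSA : S ⊆ A := Finset.erase_subset i A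
  have hSne : S ≠ A := fun h => hiS (h ▸ hiA)
  have hS𝒜 : S ∉ 𝒜 := fun h => hiS ((hsep S h).2 hjS)
  have hbelow : ∀ B ∈ 𝒜, B ≠ A → (B ⊆ S ↔ B ⊆ A) := fun B hB hBA =>
    ⟨fun h => h.trans hSA, fun h =>
      Finset.subset_erase.2 ⟨h, fun hi => hBA (hmin B hB hi h)⟩⟩
  have habove : ∀ B ∈ 𝒜, (S ⊆ B ↔ A ⊆ B) := fun B hB =>
    ⟨fun h x hx => by
      by_cases hxi : x = i
      · exact hxi ▸ (hsep B hB).2 (h hjS)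
      · exact h (Finset.mem_erase.2 ⟨hxi, hx⟩), fun h => hSA.trans h⟩
  obtain ⟨g, hg⟩ := h𝒜.2 S hS𝒜
  obtain ⟨hinj, hmem, hle⟩ := hg
  have hmem' : ∀ r, g r ≠ S → g r ∈ 𝒜 := fun r hr => (Finset.mem_insert.1 (hmem r)).resolve_left hr
  obtain ⟨a, ha⟩ : ∃ a, g a = S := by
    by_contra! h
    exact h𝒜.1 ⟨g, hinj, fun r => hmem' r (h r), hle⟩
  have hmema : ∀ r, r ≠ a → g r ∈ 𝒜 := fun r hr => hmem' r fun h => hr (hinj (h.trans ha.symm))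
  obtain ⟨b, hb⟩ : ∃ b, g b = A := by
    by_contra! h
    classical
    have hle' : ∀ r s, r ≤ s ↔ Function.update g a A r ⊆ Function.update g a A s := by
      intro r s
      by_cases hr : r = a <;> by_cases hs : s = a
      · simp [hr, hs]
      · subst hr
        rw [Function.update_self, Function.update_of_ne hs, ← habove _ (hmema s hs), hle, ha]
      · subst hs
        rw [Function.update_self, Function.update_of_ne hr, ← hbelow _ (hmema r hr) (h r), hle, ha]
      · rw [Function.update_of_ne hr, Function.update_of_ne hs, hle]
    refine h𝒜.1 ⟨Function.update g a A, fun r s hrs =>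
      le_antisymm ((hle' r s).2 hrs.subset) ((hle' s r).2 hrs.symm.subset), fun r => ?_, hle'⟩
    by_cases hr : r = a
    · simpa [hr] using hA
    · simpa [hr] using hmema r hr
  have hab : a ≤ b := (hle a b).2 (by rw [ha, hb]; exact hSA)
  have hne : a ≠ b := fun h => hSne (by rw [← ha, ← hb, h])
  refine ⟨g, a, b, ⟨hinj, hmem, hle⟩, ha, hb, hmema, ⟨lt_of_le_of_ne hab hne, fun c hac hcb => ?_⟩,
    fun r => ?_⟩
  · have hcA : g c ≠ A := fun h => hcb.ne (hinj (h.trans hb.symm))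
    have := (hbelow _ (hmema c hac.ne') hcA).2 (hb ▸ (hle c b).1 hcb.le)
    exact hac.not_ge ((hle c a).2 (ha ▸ this))
  · by_cases hra : r = a
    · subst hra
      exact iff_of_true (Or.inl le_rfl) (Or.inl hab)
    by_cases hrb : r = b
    · subst hrb
      exact iff_of_true (Or.inr hab) (Or.inl le_rfl)
    have hrA : g r ≠ A := fun h => hrb (hinj (h.trans hb.symm))
    rw [hle r a, hle a r, hle r b, hle b r, ha, hb, hbelow _ (hmema r hra) hrA,
      habove _ (hmema r hra)]

/-- A copy of the glued poset using a singleton outside `𝒜` provides a member of `𝒜` which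
contains that singleton, lies below a copy of `P2` in `𝒜`, and even lies below another such member
when `P1` has a greatest element. -/
theorem IsSaturatedFamily.exists_mem_below_copy {P1 P2 : Type*} [PartialOrder P1] [PartialOrder P2]
    [Nontrivial P1] (h1 : UCTP P1) {n : ℕ} {𝒜 : Finset (Finset (Fin n))}
    (h𝒜 : IsSaturatedFamily (P1 ⊕ₗ Unit ⊕ₗ P2) 𝒜) {i : Fin n} (hi : {i} ∉ 𝒜) :
    ∃ (C M : Finset (Fin n)) (f₂ : P2 → Finset (Fin n)), C ∈ 𝒜 ∧ i ∈ C ∧ M ∈ 𝒜 ∧ C ⊆ M ∧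
      (∀ t : P1, (∀ p, p ≤ t) → C ⊂ M) ∧ (∀ q, f₂ q ∈ 𝒜) ∧ (∀ a b, a ≤ b ↔ f₂ a ⊆ f₂ b) ∧
      ∀ q, M ⊂ f₂ q := by
  obtain ⟨f, hf⟩ := h𝒜.2 {i} hi
  have ⟨hinj, hmem, hle⟩ := hf
  have hmem' : ∀ r, f r ≠ {i} → f r ∈ 𝒜 := fun r hr =>
    (Finset.mem_insert.1 (hmem r)).resolve_left hr
  obtain ⟨z, hz⟩ : ∃ z, f z = {i} := by
    by_contra! h
    exact h𝒜.1 ⟨f, hinj, fun r => hmem' r (h r), hle⟩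
  have hmemz : ∀ r, r ≠ z → f r ∈ 𝒜 := fun r hr => hmem' r fun h => hr (hinj (h.trans hz.symm))
  have hempty : ∀ r, r < z → f r = ∅ := fun r hr =>
    Finset.ssubset_singleton_iff.1 (hz ▸ hf.ssubset hr)
  have hbelow : ∀ r s, r < z → s < z → r = s := fun r s hr hs =>
    hinj ((hempty r hr).trans (hempty s hs).symm)
  have hz_mem : ∀ r, z ≤ r → i ∈ f r := fun r hr =>
    (hle z r).1 hr (hz ▸ Finset.mem_singleton_self i)
  obtain ⟨x, y, hxy⟩ := exists_pair_ne P1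
  have hz₁ : ∃ p, z = Sum.inlₗ p := by
    rcases z with p | w
    · exact ⟨p, rfl⟩
    · exact absurd (Sum.inl_injective (hbelow (Sum.inlₗ x) (Sum.inlₗ y)
        (Sum.Lex.inl_lt_inr _ _) (Sum.Lex.inl_lt_inr _ _))) hxy
  obtain ⟨p, rfl⟩ := hz₁
  have hM : f (Sum.inrₗ (Sum.inlₗ ())) ∈ 𝒜 := hmemz _ (Sum.Lex.inl_lt_inr _ _).ne'
  have hf₂ : ∀ q, f (Sum.inrₗ (Sum.inrₗ q)) ∈ 𝒜 := fun q => hmemz _ (Sum.Lex.inl_lt_inr _ _).ne'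
  have hle₂ : ∀ a b : P2, a ≤ b ↔ f (Sum.inrₗ (Sum.inrₗ a)) ⊆ f (Sum.inrₗ (Sum.inrₗ b)) :=
    fun a b => (Sum.Lex.inr_le_inr_iff.trans Sum.Lex.inr_le_inr_iff).symm.trans (hle _ _)
  have hM₂ : ∀ q, f (Sum.inrₗ (Sum.inlₗ ())) ⊂ f (Sum.inrₗ (Sum.inrₗ q)) := fun q =>
    hf.ssubset (Sum.Lex.inr_lt_inr_iff.2 (Sum.Lex.inl_lt_inr _ _))
  by_cases hu : ∃ u, p < u
  · obtain ⟨u, hu⟩ := hu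
    have hlt : (Sum.inlₗ p : P1 ⊕ₗ Unit ⊕ₗ P2) < Sum.inlₗ u := Sum.Lex.inl_lt_inl_iff.2 hu
    have hC := hf.ssubset (Sum.Lex.inl_lt_inr u (toLex (Sum.inl () : Unit ⊕ P2)))
    exact ⟨_, _, _, hmemz _ hlt.ne', hz_mem _ hlt.le, hM, hC.1, fun _ _ => hC, hf₂, hle₂, hM₂⟩
  · refine ⟨_, _, _, hM, hz_mem _ (Sum.Lex.inl_le_inr _ _), hM, subset_rfl, fun t ht => ?_, hf₂,
      hle₂, hM₂⟩
    have hp : ∀ r, r ≤ p := by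
      have : p = t := (ht p).eq_of_not_lt fun h => hu ⟨t, h⟩
      exact this ▸ ht
    have heq : ∀ r s, r ≠ p → s ≠ p → r = s := fun r s hr hs =>
      Sum.inl_injective (hbelow (Sum.inlₗ r) (Sum.inlₗ s)
        (Sum.Lex.inl_lt_inl_iff.2 ((hp r).lt_of_ne hr))
        (Sum.Lex.inl_lt_inl_iff.2 ((hp s).lt_of_ne hs)))
    obtain ⟨x, hx⟩ := exists_ne p
    have hcov : x ⋖ p := ⟨(hp x).lt_of_ne hx, fun c hxc hcp =>
      hxc.ne (heq x c hx hcp.ne)⟩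
    obtain ⟨r, hr⟩ := h1 x p hcov
    have hrx : r ≤ x ∨ x ≤ r := by
      by_cases hrp : r = p
      · exact Or.inr (hrp ▸ hp x)
      · exact Or.inl (heq r x hrp hx).le
    rcases hr with ⟨-, h⟩ | ⟨-, h⟩
    · exact absurd (Or.inl (hp r)) h
    · exact absurd hrx h

/-- A saturated family for the glued poset separates points. -/
theorem IsSaturatedFamily.exists_separating {P1 P2 : Type*} [PartialOrder P1] [PartialOrder P2]
    [Nontrivial P1] (h1 : UCTP P1) {n : ℕ} {𝒜 : Finset (Finset (Fin n))}
    (h𝒜 : IsSaturatedFamily (P1 ⊕ₗ Unit ⊕ₗ P2) 𝒜) {i j : Fin n} (hij : i ≠ j) :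
    ∃ B ∈ 𝒜, ¬(i ∈ B ↔ j ∈ B) := by
  by_contra! hsep
  have hi : {i} ∉ 𝒜 := fun h => hij.symm (by simpa using hsep _ h)
  obtain ⟨C, M, f₂, hC, hiC, hM, hCM, htop, hf₂, hle₂, hM₂⟩ := h𝒜.exists_mem_below_copy h1 hi
  obtain ⟨A, hAC, hAmin⟩ := (𝒜.filter (i ∈ ·)).exists_le_minimal (Finset.mem_filter.2 ⟨hC, hiC⟩)
  obtain ⟨hA, hiA⟩ := Finset.mem_filter.1 hAmin.prop
  obtain ⟨g, a, b, hg, ha, hb, hgmem, hcov, htwin⟩ :=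
    h𝒜.exists_cover_twins hij hsep hA hiA fun B hB hiB hBA =>
      hAmin.eq_of_le (Finset.mem_filter.2 ⟨hB, hiB⟩) hBA
  have hle₁ : ∀ x y : P1, x ≤ y ↔ g (Sum.inlₗ x) ⊆ g (Sum.inlₗ y) := fun x y =>
    Sum.Lex.inl_le_inl_iff.symm.trans (hg.2.2 _ _)
  have hA₂ : ∀ q, A ⊂ f₂ q := fun q => (hAC.trans hCM).trans_ssubset (hM₂ q)
  rcases b with b | ⟨⟨⟩⟩ | b
  · rcases a with a | a
    · have hcov' : a ⋖ b := ⟨Sum.Lex.inl_lt_inl_iff.1 hcov.1, fun c hac hcb =>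
        hcov.2 (Sum.Lex.inl_lt_inl_iff.2 hac) (Sum.Lex.inl_lt_inl_iff.2 hcb)⟩
      obtain ⟨r, hr⟩ := h1 a b hcov'
      have htr : (r ≤ a ∨ a ≤ r) ↔ (r ≤ b ∨ b ≤ r) := by
        have hle : ∀ x y : P1, (Sum.inlₗ x : P1 ⊕ₗ Unit ⊕ₗ P2) ≤ Sum.inlₗ y ↔ x ≤ y :=
          fun _ _ => Sum.Lex.inl_le_inl_iff
        exact (or_congr (hle r a) (hle a r)).symm.trans
          ((htwin (Sum.inlₗ r)).trans (or_congr (hle r b) (hle b r)))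
      exact (xor_iff_not_iff _ _).1 hr htr
    · exact Sum.Lex.not_inr_lt_inl hcov.1
  · rcases a with t | a
    · have ht : ∀ p, p ≤ t := fun p => by
        have := (htwin (Sum.inlₗ p)).2 (Or.inl (Sum.Lex.inl_le_inr _ _))
        rcases this with h | h
        · exact Sum.Lex.inl_le_inl_iff.1 h
        · have htp : t ≤ p := Sum.Lex.inl_le_inl_iff.1 h
          refine (htp.eq_of_not_lt fun hlt => ?_).ge
          exact hcov.2 (Sum.Lex.inl_lt_inl_iff.2 hlt) (Sum.Lex.inl_lt_inr _ _)
      classical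
      have hne : ∀ p, p ≠ t → g (Sum.inlₗ p) ⊂ A := fun p _ =>
        hb ▸ hg.ssubset (Sum.Lex.inl_lt_inr _ _)
      have hAM : A ⊂ M := hAC.trans_ssubset (htop t ht)
      refine h𝒜.1 (containsCopy_glue (f₁ := Function.update (fun p => g (Sum.inlₗ p)) t A)
        (fun p => ?_) hM hf₂ (fun x y => ?_) hle₂ (fun p => ?_) hM₂)
      · by_cases hp : p = t
        · simpa [hp] using hA
        · rw [Function.update_of_ne hp]
          exact hgmem _ fun h => hp (Sum.inl_injective h)
      · by_cases hx : x = t <;> by_cases hy : y = t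
        · simp [hx, hy]
        · subst hx
          rw [Function.update_self, Function.update_of_ne hy]
          exact iff_of_false (fun h => hy ((ht y).antisymm h)) (hne y hy).2
        · subst hy
          rw [Function.update_self, Function.update_of_ne hx]
          exact iff_of_true (ht x) (hne x hx).1
        · rw [Function.update_of_ne hx, Function.update_of_ne hy]
          exact hle₁ x y
      · by_cases hp : p = t
        · simpa [hp] using hAM
        · rw [Function.update_of_ne hp]
          exact (hne p hp).trans hAM
    · rcases a with ⟨⟨⟩⟩ | a
      · exact hcov.1.false
      · exact Sum.Lex.not_inr_lt_inl (Sum.Lex.inr_lt_inr_iff.1 hcov.1)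
  · rcases a with a | ⟨⟨⟩⟩ | a
    · exact hcov.2 (Sum.Lex.inl_lt_inr a (toLex (Sum.inl ())))
        (Sum.Lex.inr_lt_inr_iff.2 (Sum.Lex.inl_lt_inr _ _))
    · exact h𝒜.1 (containsCopy_glue (fun p => hgmem (Sum.inlₗ p) (Sum.Lex.inl_lt_inr _ _).ne) hA
        hf₂ hle₁ hle₂ (fun p => hb ▸ hg.ssubset (Sum.Lex.inl_lt_inr _ _)) hA₂)
    · have hma : (Sum.inrₗ (Sum.inlₗ ()) : P1 ⊕ₗ Unit ⊕ₗ P2) < Sum.inrₗ (Sum.inrₗ a) :=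
        Sum.Lex.inr_lt_inr_iff.2 (Sum.Lex.inl_lt_inr _ _)
      exact h𝒜.1 (containsCopy_glue (fun p => hgmem (Sum.inlₗ p) (Sum.Lex.inl_lt_inr _ _).ne)
        (hgmem _ hma.ne) hf₂ hle₁ hle₂ (fun p => hg.ssubset (Sum.Lex.inl_lt_inr _ _))
        fun q => (hb ▸ hg.ssubset (hma.trans hcov.1)).trans (hA₂ q))

/-- A family separating the points of `Fin n` has at least `log₂ n` members. -/
theorem le_two_pow_card_of_separating {n : ℕ} {𝒜 : Finset (Finset (Fin n))}
    (h : ∀ i j : Fin n, i ≠ j → ∃ B ∈ 𝒜, ¬(i ∈ B ↔ j ∈ B)) : n ≤ 2 ^ 𝒜.card := by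
  have hcard := Finset.card_le_card_of_injOn (s := (Finset.univ : Finset (Fin n)))
    (t := 𝒜.powerset) (fun i => 𝒜.filter (i ∈ ·))
    (fun i _ => Finset.mem_coe.2 (Finset.mem_powerset.2 (Finset.filter_subset _ _)))
    (fun i _ j _ hij => by
      by_contra hne
      obtain ⟨B, hB, hsep⟩ := h i j hne
      have := Finset.ext_iff.1 hij B
      simp only [Finset.mem_filter, hB, true_and] at this
      exact hsep this)
  simpa using hcard

theorem exists_isSaturatedFamily (α : Type*) [PartialOrder α] [Nonempty α] (n : ℕ) :
    ∃ 𝒜 : Finset (Finset (Fin n)), IsSaturatedFamily α 𝒜 := by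
  have hempty : ¬ContainsCopy α (∅ : Finset (Finset (Fin n))) := fun ⟨_, hf⟩ =>
    Finset.notMem_empty _ (hf.2.1 (Classical.arbitrary α))
  obtain ⟨𝒜, h𝒜⟩ := (Set.toFinite {𝒜 : Finset (Finset (Fin n)) | ¬ContainsCopy α 𝒜}).exists_maximal
    ⟨∅, hempty⟩
  refine ⟨𝒜, h𝒜.prop, fun S hS => ?_⟩
  by_contra h
  exact hS (h𝒜.le_of_ge h (Finset.subset_insert S 𝒜) (Finset.mem_insert_self S 𝒜))

theorem exists_isSaturatedFamily_card_eq_satStar (α : Type*) [PartialOrder α] [Nonempty α]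
    (n : ℕ) : ∃ 𝒜 : Finset (Finset (Fin n)), IsSaturatedFamily α 𝒜 ∧ 𝒜.card = satStar α n := by
  obtain ⟨𝒜, h𝒜⟩ := exists_isSaturatedFamily α n
  exact Nat.sInf_mem (s := {k | ∃ 𝒜 : Finset (Finset (Fin n)), IsSaturatedFamily α 𝒜 ∧ 𝒜.card = k})
    ⟨_, 𝒜, h𝒜, rfl⟩

/-- If `P1` is a finite poset with the UCTP and at least 2 elements and
`P2` is any finite poset, then `sat*(n, P2 * • * P1) → ∞` as `n → ∞`. Here the linear sum
`P2 * • * P1` (with `P1` at the bottom) is encoded as `P1 ⊕ₗ Unit ⊕ₗ P2`. -/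
theorem statement0 (P1 P2 : Type*) [PartialOrder P1] [Fintype P1]
    [PartialOrder P2] [Fintype P2]
    (h1 : UCTP P1) (h2 : 2 ≤ Fintype.card P1) :
    Tendsto (fun n => satStar (P1 ⊕ₗ Unit ⊕ₗ P2) n) atTop atTop := by
  have : Nontrivial P1 := Fintype.one_lt_card_iff_nontrivial.1 h2
  have : Nonempty (P1 ⊕ₗ Unit ⊕ₗ P2) := ⟨Sum.inrₗ (Sum.inlₗ ())⟩
  refine tendsto_atTop.2 fun k => (eventually_ge_atTop (2 ^ k)).mono fun n hn => ?_
  obtain ⟨𝒜, h𝒜, hcard⟩ := exists_isSaturatedFamily_card_eq_satStar (P1 ⊕ₗ Unit ⊕ₗ P2) n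
  have hle := le_two_pow_card_of_separating fun i j hij => h𝒜.exists_separating h1 hij
  rw [hcard] at hle
  exact (Nat.pow_le_pow_iff_right one_lt_two).1 (hn.trans hle)
end

section
/- Let k ≥ 1 and let n1, ..., nk be integers all at least 2. Then sat*(n, K_{n1,...,nk}) = O(n); that is, there exists a constant C (depending only on n1, ..., nk) such that sat*(n, K_{n1,...,nk}) ≤ C · n for all sufficiently large n. -/
open Finset Filter

/-- The complete `k`-layered poset `K_{ns 0, …, ns (k-1)}`: layer `i` is an antichain of
size `ns i`, and every element of a lower layer is below every element of a higher
layer. -/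
def KPoset {k : ℕ} (ns : Fin k → ℕ) : Type := Σ i : Fin k, Fin (ns i)

instance {k : ℕ} (ns : Fin k → ℕ) : PartialOrder (KPoset ns) where
  le x y := x = y ∨ x.1 < y.1
  le_refl x := Or.inl rfl
  le_trans x y z hxy hyz := by
    rcases hxy with rfl | h
    · exact hyz
    · rcases hyz with rfl | h2
      · exact Or.inr h
      · exact Or.inr (h.trans h2)
  le_antisymm x y hxy hyx := by
    rcases hxy with rfl | h
    · rfl
    · rcases hyx with rfl | h2
      · rfl
      · exact absurd (h.trans h2) (lt_irrefl _)

/-- A signature structure on `M`: the vertex `x` reads off a signature of every vertex and stores a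
finite set of accepted signatures. A finite set is an apex set if some member `x` accepts all the
other members, which have pairwise distinct signatures exhausting the accepted ones, while none of
them accepts `x`. -/
def IsApexOf {M Λ : Type*} [DecidableEq M] [DecidableEq Λ] (sig : M → M → Λ) (R : M → Finset Λ)
    (U : Finset M) (x : M) : Prop :=
  x ∈ U ∧ (U.erase x).image (sig x) = R x ∧ #(R x) + 1 = #U ∧ ∀ v ∈ U.erase x, sig v x ∉ R v

theorem IsApexOf.injOn {M Λ : Type*} [DecidableEq M] [DecidableEq Λ] {sig : M → M → Λ}
    {R : M → Finset Λ} {U : Finset M} {x : M} (h : IsApexOf sig R U x) :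
    Set.InjOn (sig x) (U.erase x) := by
  rw [← Finset.card_image_iff, h.2.1, Finset.card_erase_of_mem h.1, ← h.2.2.1]
  simp

theorem card_nonkilling_le {M Λ : Type*} [DecidableEq M] [DecidableEq Λ] {sig : M → M → Λ}
    {R : M → Finset Λ} {W U : Finset M} {x : M} {p e : ℕ} (hW : #W = p + e) (hU : #U = p)
    (hUW : U ⊆ W) (h : IsApexOf sig R U x) (T : Finset M)
    (hT : ∀ w ∈ T, w ∈ W ∧ ∃ U' ⊆ W.erase w, IsApexOf sig R U' x) : #T ≤ 2 * e := by
  classical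
  have hd : #(W \ U) = e := by rw [Finset.card_sdiff_of_subset hUW]; omega
  have hsub : T ⊆ (W \ U) ∪ (U.erase x).filter (fun w ↦ sig x w ∈ (W \ U).image (sig x)) := by
    intro w hw
    obtain ⟨hwW, U', hU', h'⟩ := hT w hw
    by_cases hwU : w ∈ U
    · have hwx : w ≠ x := by
        rintro rfl
        exact (Finset.mem_erase.1 (hU' h'.1)).1 rfl
      have hwe : w ∈ U.erase x := Finset.mem_erase.2 ⟨hwx, hwU⟩
      have hs : sig x w ∈ (U'.erase x).image (sig x) := by
        rw [h'.2.1, ← h.2.1]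
        exact Finset.mem_image_of_mem _ hwe
      obtain ⟨y, hy, hyw⟩ := Finset.mem_image.1 hs
      have hyU' := hU' (Finset.mem_of_mem_erase hy)
      refine Finset.mem_union_right _ (Finset.mem_filter.2 ⟨hwe, ?_⟩)
      refine Finset.mem_image.2 ⟨y, Finset.mem_sdiff.2 ⟨Finset.mem_of_mem_erase hyU', ?_⟩, hyw⟩
      intro hyU
      have hye : y ∈ U.erase x := Finset.mem_erase.2 ⟨(Finset.mem_erase.1 hy).1, hyU⟩
      exact (Finset.mem_erase.1 hyU').1 (h.injOn hye hwe hyw)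
    · exact Finset.mem_union_left _ (Finset.mem_sdiff.2 ⟨hwW, hwU⟩)
  have h2 : #((U.erase x).filter (fun w ↦ sig x w ∈ (W \ U).image (sig x))) ≤ e := by
    refine le_trans ?_ (Finset.card_image_le.trans hd.le : #((W \ U).image (sig x)) ≤ e)
    refine Finset.card_le_card_of_injOn (sig x) (fun w hw ↦ (Finset.mem_filter.1 hw).2) ?_
    exact h.injOn.mono (by exact_mod_cast Finset.filter_subset _ _)
  calc #T ≤ _ := Finset.card_le_card hsub
    _ ≤ _ := Finset.card_union_le _ _
    _ ≤ 2 * e := by omega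

theorem card_apex_le {M Λ : Type*} [DecidableEq M] [DecidableEq Λ] {sig : M → M → Λ}
    {R : M → Finset Λ} {W : Finset M} {p e : ℕ} (hW : #W = p + e) (K : Finset M)
    (hK : ∀ x ∈ K, ∃ U ⊆ W, #U = p ∧ IsApexOf sig R U x) : #K ≤ 2 * e + 1 := by
  classical
  choose! U hUW hUp hU using hK
  have hKW : K ⊆ W := fun x hx ↦ hUW x hx (hU x hx).1
  set A := K.sigma (fun x ↦ W \ U x) with hA
  have hAc : #A ≤ #K * e := by
    rw [hA, Finset.card_sigma]
    refine (Finset.sum_le_card_nsmul _ _ e fun x hx ↦ ?_).trans (by simp)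
    rw [Finset.card_sdiff_of_subset (hUW x hx), hUp x hx]; omega
  have hoff : K.offDiag ⊆ A.image (fun z ↦ (z.1, z.2)) ∪ A.image (fun z ↦ (z.2, z.1)) := by
    rintro ⟨x, y⟩ hxy
    obtain ⟨hx, hy, hne⟩ := Finset.mem_offDiag.1 hxy
    simp only at hx hy hne
    by_cases h1 : y ∈ U x
    · by_cases h2 : x ∈ U y
      · exfalso
        have hy' : y ∈ (U x).erase x := Finset.mem_erase.2 ⟨hne.symm, h1⟩
        have hx' : x ∈ (U y).erase y := Finset.mem_erase.2 ⟨hne, h2⟩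
        apply (hU x hx).2.2.2 y hy'
        rw [← (hU y hy).2.1]
        exact Finset.mem_image_of_mem _ hx'
      · refine Finset.mem_union_right _ (Finset.mem_image.2 ⟨⟨y, x⟩, ?_, rfl⟩)
        exact Finset.mem_sigma.2 ⟨hy, Finset.mem_sdiff.2 ⟨hKW hx, h2⟩⟩
    · refine Finset.mem_union_left _ (Finset.mem_image.2 ⟨⟨x, y⟩, ?_, rfl⟩)
      exact Finset.mem_sigma.2 ⟨hx, Finset.mem_sdiff.2 ⟨hKW hy, h1⟩⟩
  have h3 : #K * #K - #K ≤ 2 * (#K * e) := by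
    rw [← Finset.offDiag_card]
    refine (Finset.card_le_card hoff).trans ((Finset.card_union_le _ _).trans ?_)
    have a1 := Finset.card_image_le (s := A) (f := fun z ↦ (z.1, z.2))
    have a2 := Finset.card_image_le (s := A) (f := fun z ↦ (z.2, z.1))
    omega
  by_contra! hlt
  have : #K * (2 * e + 2) ≤ #K * #K := Nat.mul_le_mul_left _ hlt
  have h0 : 0 < #K := by omega
  have : #K * (2 * e + 2) = 2 * (#K * e) + 2 * #K := by ring
  omega

theorem exists_killing {M Λ : Type*} [DecidableEq M] [DecidableEq Λ] (sig : M → M → Λ)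
    (R : M → Finset Λ) {W : Finset M} {p e : ℕ} (hW : #W = p + e)
    (hlarge : (2 * e + 1) * (2 * e) + e ≤ #W) :
    ∃ D ⊆ W, #D = e ∧ ∀ w ∈ D, ∀ U ⊆ W.erase w, #U = p → ¬ ∃ x, IsApexOf sig R U x := by
  classical
  set K := W.filter (fun x ↦ ∃ U ⊆ W, #U = p ∧ IsApexOf sig R U x) with hK
  have hKc : #K ≤ 2 * e + 1 := card_apex_le (sig := sig) (R := R) hW K
    fun x hx ↦ (Finset.mem_filter.1 hx).2
  set bad := fun x ↦ W.filter (fun w ↦ ∃ U ⊆ W.erase w, #U = p ∧ IsApexOf sig R U x) with hbad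
  have hbc : ∀ x ∈ K, #(bad x) ≤ 2 * e := by
    intro x hx
    obtain ⟨U, hUW, hUp, hU⟩ := (Finset.mem_filter.1 hx).2
    refine card_nonkilling_le hW hUp hUW hU _ fun w hw ↦ ?_
    obtain ⟨hwW, U', hU', -, h'⟩ := Finset.mem_filter.1 hw
    exact ⟨hwW, U', hU', h'⟩
  have hBc : #(K.biUnion bad) ≤ (2 * e + 1) * (2 * e) :=
    (Finset.card_biUnion_le_card_mul _ _ _ hbc).trans (Nat.mul_le_mul_right _ hKc)
  have hbig : e ≤ #(W \ K.biUnion bad) := by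
    have := Finset.le_card_sdiff (K.biUnion bad) W
    omega
  obtain ⟨D, hD, hDc⟩ := Finset.exists_subset_card_eq hbig
  refine ⟨D, hD.trans Finset.sdiff_subset, hDc, ?_⟩
  rintro w hw U hU hUp ⟨x, hx⟩
  obtain ⟨hwW, hwB⟩ := Finset.mem_sdiff.1 (hD hw)
  apply hwB
  have hUW : U ⊆ W := hU.trans (Finset.erase_subset _ _)
  exact Finset.mem_biUnion.2 ⟨x, Finset.mem_filter.2 ⟨hUW hx.1, U, hUW, hUp, hx⟩,
    Finset.mem_filter.2 ⟨hwW, U, hU, hUp, hx⟩⟩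

theorem exists_mul_pow_le_two_pow (K q : ℕ) : ∃ D : ℕ, 0 < D ∧ K * D ^ q ≤ 2 ^ D := by
  have h := tendsto_pow_const_mul_const_pow_of_abs_lt_one (r := (1 / 2 : ℝ)) q
    (by rw [abs_of_pos] <;> norm_num)
  have h2 := (h.const_mul (K : ℝ)).eventually (gt_mem_nhds (show (K : ℝ) * 0 < 1 by simp))
  obtain ⟨D, hD, hD0⟩ := (h2.and (eventually_gt_atTop 0)).exists
  refine ⟨D, hD0, ?_⟩
  have h3 : (K : ℝ) * D ^ q / 2 ^ D < 1 := by
    calc (K : ℝ) * D ^ q / 2 ^ D = K * (D ^ q * (1 / 2) ^ D) := by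
          rw [one_div, inv_pow]; ring
      _ < 1 := hD
  rw [div_lt_one (by positivity)] at h3
  exact_mod_cast h3.le

/-- For every `s` and `m` there is a finite signature structure in which each nonempty set of at
most `s` vertices can be completed to an apex set in `m` ways. -/
theorem exists_signature_structure (s m : ℕ) :
    ∃ (M Λ : Type) (_ : Fintype M) (_ : DecidableEq M) (_ : DecidableEq Λ) (sig : M → M → Λ)
      (R : M → Finset Λ), (0 < m → Nonempty M) ∧ ∀ V : Finset M, V.Nonempty → #V ≤ s →
        ∃ X : Finset M, #X = m ∧ ∀ x ∈ X, x ∉ V ∧ IsApexOf sig R (insert x V) x := by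
  classical
  let Λ := Fin (s * s + 1) × (Fin s × Fin s → Bool)
  let RT := {R : Finset Λ // #R ≤ s}
  obtain ⟨D, hD0, hD⟩ := exists_mul_pow_le_two_pow ((s * s + 1) * (Fintype.card RT * m)) (s * s)
  let M := Fin (s * s + 1) × (Fin s × Fin s → Fin D) × RT × Fin m
  have hcard : Fintype.card M ≤ Fintype.card (Fin D → Bool) := by
    simp only [M, Fintype.card_prod, Fintype.card_fun, Fintype.card_fin, Fintype.card_bool]
    refine le_trans (le_of_eq ?_) hD
    ring
  obtain ⟨bits⟩ := Function.Embedding.nonempty_of_card_le hcard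
  let sig : M → M → Λ := fun x v ↦ (v.1, fun ij ↦ bits v (x.2.1 ij))
  refine ⟨M, Λ, inferInstance, inferInstance, inferInstance, sig, fun x ↦ x.2.2.1.1,
    fun hm ↦ ⟨0, fun _ ↦ ⟨0, hD0⟩, ⟨∅, by simp⟩, ⟨0, hm⟩⟩, ?_⟩
  intro V hV hVs
  have : Nonempty V := hV.to_subtype
  obtain ⟨g⟩ : Nonempty (V ↪ Fin s) :=
    Function.Embedding.nonempty_of_card_le (by simpa using hVs)
  let v : Fin s → V := Function.invFun g
  have hv : Function.Surjective v := Function.invFun_surjective g.injective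
  have hJ : ∀ ij : Fin s × Fin s, ∃ d : Fin D,
      v ij.1 ≠ v ij.2 → bits (v ij.1) d ≠ bits (v ij.2) d := by
    intro ij
    by_cases h : v ij.1 = v ij.2
    · exact ⟨⟨0, hD0⟩, fun h' ↦ (h' h).elim⟩
    · have : bits (v ij.1) ≠ bits (v ij.2) := fun hb ↦ h (Subtype.ext (bits.injective hb))
      obtain ⟨d, hd⟩ := Function.ne_iff.1 this
      exact ⟨d, fun _ ↦ hd⟩
  choose J hJ using hJ
  let σ : M → Λ := fun y ↦ (y.1, fun ij ↦ bits y (J ij))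
  have hσ : Set.InjOn σ V := by
    intro y hy z hz hyz
    obtain ⟨i, hi⟩ := hv ⟨y, hy⟩
    obtain ⟨j, hj⟩ := hv ⟨z, hz⟩
    by_contra hne
    have h1 := hJ (i, j) (by simp only [hi, hj]; exact fun h ↦ hne (congrArg Subtype.val h))
    simp only [hi, hj] at h1
    exact h1 (congrFun (congrArg Prod.snd hyz) (i, j))
  let R₀ : RT := ⟨V.image σ, Finset.card_image_le.trans hVs⟩
  have hfresh : ∃ a : Fin (s * s + 1), a ∉ V.biUnion fun y ↦ y.2.2.1.1.image Prod.fst := by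
    by_contra! hall
    have h1 : #(V.biUnion fun y ↦ y.2.2.1.1.image Prod.fst) ≤ #V * s :=
      Finset.card_biUnion_le_card_mul _ _ _ fun y _ ↦ Finset.card_image_le.trans y.2.2.1.2
    rw [Finset.eq_univ_of_forall hall, Finset.card_univ, Fintype.card_fin] at h1
    have := Nat.mul_le_mul_right s hVs
    omega
  obtain ⟨a, ha⟩ := hfresh
  let mk : Fin m → M := fun c ↦ (a, J, R₀, c)
  have hlose : ∀ c, ∀ y ∈ V, sig y (mk c) ∉ y.2.2.1.1 := fun c y hy h ↦
    ha (Finset.mem_biUnion.2 ⟨y, hy, Finset.mem_image.2 ⟨_, h, rfl⟩⟩)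
  refine ⟨Finset.univ.image mk, ?_, ?_⟩
  · rw [Finset.card_image_of_injective, Finset.card_univ, Fintype.card_fin]
    intro c d hcd
    exact congrArg (fun x : M ↦ x.2.2.2) hcd
  · intro x hx
    obtain ⟨c, -, rfl⟩ := Finset.mem_image.1 hx
    have hxV : mk c ∉ V := fun h ↦ hlose c _ h (Finset.mem_image_of_mem σ h)
    refine ⟨hxV, Finset.mem_insert_self _ _, ?_, ?_, ?_⟩
    · rw [Finset.erase_insert hxV]
    · rw [Finset.card_insert_of_notMem hxV]
      exact congrArg (· + 1) (Finset.card_image_of_injOn hσ)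
    · rw [Finset.erase_insert hxV]
      exact hlose c

/-- The hypergraph used in the construction: sets of at most `s` vertices are contained in many
edges one larger, yet every large set `W` has many vertices meeting all its edges
of size `#W - e`. -/
theorem exists_hypergraph (s e : ℕ) :
    ∃ (N : ℕ) (E : Finset (Fin N) → Prop), (0 < e → 0 < N) ∧
      (∀ V : Finset (Fin N), V.Nonempty → #V ≤ s →
        ∃ X : Finset (Fin N), #X = e ∧ ∀ x ∈ X, x ∉ V ∧ E (insert x V)) ∧
      ∀ (W : Finset (Fin N)) (p : ℕ), #W = p + e → (2 * e + 1) * (2 * e) + e ≤ #W →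
        ∃ D ⊆ W, #D = e ∧ ∀ w ∈ D, ∀ U ⊆ W.erase w, #U = p → ¬ E U := by
  classical
  obtain ⟨M, Λ, _, _, _, sig, R, hpos, h⟩ := exists_signature_structure s e
  let φ := (Fintype.equivFin M).symm
  let sig' : Fin (Fintype.card M) → Fin (Fintype.card M) → Λ := fun x y ↦ sig (φ x) (φ y)
  let R' : Fin (Fintype.card M) → Finset Λ := fun x ↦ R (φ x)
  refine ⟨Fintype.card M, fun U ↦ ∃ x, IsApexOf sig' R' U x,
    fun he ↦ have := hpos he; Fintype.card_pos, ?_, ?_⟩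
  · intro V hV hVs
    obtain ⟨X, hX, hXV⟩ := h (V.map φ.toEmbedding) (hV.map) (by simpa using hVs)
    refine ⟨X.map φ.symm.toEmbedding, by simpa using hX, ?_⟩
    intro x hx
    obtain ⟨y, hy, rfl⟩ := Finset.mem_map.1 hx
    obtain ⟨hyV, -, h1, h2, h3⟩ := hXV y hy
    rw [Finset.erase_insert hyV] at h1 h3
    rw [Finset.card_insert_of_notMem hyV] at h2
    have hyV' : φ.symm y ∉ V := fun hm ↦ hyV (Finset.mem_map.2 ⟨_, hm, by simp⟩)
    refine ⟨hyV', φ.symm y, Finset.mem_insert_self _ _, ?_, ?_, ?_⟩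
    · simp only [Equiv.coe_toEmbedding, Finset.erase_insert hyV']
      rw [Finset.map_eq_image, Finset.image_image] at h1
      simpa [sig', R', Function.comp_def] using h1
    · simp only [Equiv.coe_toEmbedding, Finset.card_insert_of_notMem hyV']
      simpa [R'] using h2
    · simp only [Equiv.coe_toEmbedding, Finset.erase_insert hyV']
      intro v hv
      simpa [sig', R'] using h3 (φ v) (Finset.mem_map_of_mem _ hv)
  · intro W p hW hl
    exact exists_killing sig' R' hW hl

/-- The trace of `S` along an embedding. -/
def tr {N n : ℕ} (ι : Fin N ↪ Fin n) (S : Finset (Fin n)) : Finset (Fin N) :=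
  Finset.univ.filter fun x ↦ ι x ∈ S

/-- The least set with a given trace. -/
def lowSet {N n : ℕ} (ι : Fin N ↪ Fin n) (A : Finset (Fin N)) : Finset (Fin n) := A.map ι

/-- The greatest set with a given trace. -/
def upSet {N n : ℕ} (ι : Fin N ↪ Fin n) (A : Finset (Fin N)) : Finset (Fin n) := (Aᶜ.map ι)ᶜ

section Trace

variable {N n : ℕ} (ι : Fin N ↪ Fin n)

theorem tr_mono {S T : Finset (Fin n)} (h : S ⊆ T) : tr ι S ⊆ tr ι T := by
  intro x hx
  simp only [tr, Finset.mem_filter, Finset.mem_univ, true_and] at hx ⊢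
  exact h hx

theorem tr_lowSet (A : Finset (Fin N)) : tr ι (lowSet ι A) = A := by
  ext x; simp [tr, lowSet]

theorem tr_upSet (A : Finset (Fin N)) : tr ι (upSet ι A) = A := by
  ext x; simp [tr, upSet]

theorem lowSet_subset_iff (A : Finset (Fin N)) (S : Finset (Fin n)) :
    lowSet ι A ⊆ S ↔ A ⊆ tr ι S := by
  simp [lowSet, tr, Finset.subset_iff]

theorem subset_upSet_iff (A : Finset (Fin N)) (S : Finset (Fin n)) :
    S ⊆ upSet ι A ↔ tr ι S ⊆ A := by
  simp only [upSet, tr, Finset.subset_iff, Finset.mem_compl, Finset.mem_map, Finset.mem_filter,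
    Finset.mem_univ, true_and]
  constructor
  · intro h x hx
    by_contra hxA
    exact h hx ⟨x, hxA, rfl⟩
  · rintro h _ hy ⟨x, hxA, rfl⟩
    exact hxA (h hy)

end Trace

/-- `A` has size `B + (i + 1) * e - 1` and contains no edge of size `B + i * e`. -/
def IsLower {N : ℕ} (E : Finset (Fin N) → Prop) (B e i : ℕ) (A : Finset (Fin N)) : Prop :=
  #A + 1 = B + (i + 1) * e ∧ ∀ U ⊆ A, #U = B + i * e → ¬ E U

/-- `A` is an edge of size `B + i * e`. -/
def IsUpper {N : ℕ} (E : Finset (Fin N) → Prop) (B e i : ℕ) (A : Finset (Fin N)) : Prop :=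
  #A = B + i * e ∧ E A

/-- Members of the base family: lower sets of all layers except the last one, with nothing outside
the range of `ι`, and upper sets of all layers except the first one, with everything outside it. -/
def IsBase {N n : ℕ} (ι : Fin N ↪ Fin n) (E : Finset (Fin N) → Prop) (B e k : ℕ)
    (S : Finset (Fin n)) : Prop :=
  (∃ i A, i + 1 < k ∧ IsLower E B e i A ∧ S = lowSet ι A) ∨
    ∃ i A, 1 ≤ i ∧ i < k ∧ IsUpper E B e i A ∧ S = upSet ι A

theorem exists_lower_chain {N : ℕ} {E : Finset (Fin N) → Prop} {B e : ℕ}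
    (hE : ∀ (W : Finset (Fin N)) (p : ℕ), #W = p + e → (2 * e + 1) * (2 * e) + e ≤ #W →
        ∃ D ⊆ W, #D = e ∧ ∀ w ∈ D, ∀ U ⊆ W.erase w, #U = p → ¬ E U)
    (hB : (2 * e + 1) * (2 * e) ≤ B) (j : ℕ) :
    ∀ W : Finset (Fin N), (j = 0 ∨ B + j * e ≤ #W) →
      ∃ g : ℕ → Fin e → Finset (Fin N),
        (∀ i < j, ∀ a, g i a ⊆ W ∧ IsLower E B e i (g i a)) ∧
        (∀ i < j, Function.Injective (g i)) ∧
        ∀ i i', i < i' → i' < j → ∀ a b, g i a ⊆ g i' b := by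
  induction j with
  | zero => intro W _; exact ⟨fun _ _ ↦ ∅, by simp, by simp, by simp⟩
  | succ j ih =>
    intro W hW
    obtain ⟨W', hW'W, hW'⟩ := Finset.exists_subset_card_eq (hW.resolve_left (by omega))
    have hmul : (j + 1) * e = j * e + e := by ring
    obtain ⟨D, hDW, hDe, hD⟩ := hE W' (B + j * e) (by omega) (by omega)
    obtain ⟨g, hg1, hg2, hg3⟩ := ih (W' \ D) (Or.inr (by
      rw [Finset.card_sdiff_of_subset hDW]; omega))
    let d := (D.equivFinOfCardEq hDe).symm
    have hsub : ∀ i < j, ∀ a b, g i a ⊆ W'.erase (d b) := by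
      intro i hi a b x hx
      have hx' := Finset.mem_sdiff.1 ((hg1 i hi a).1 hx)
      refine Finset.mem_erase.2 ⟨?_, hx'.1⟩
      rintro rfl
      exact hx'.2 (d b).2
    refine ⟨fun i a ↦ if i = j then W'.erase (d a) else g i a, ?_, ?_, ?_⟩
    · intro i hi a
      by_cases hij : i = j
      · subst hij
        simp only [if_true]
        refine ⟨(Finset.erase_subset _ _).trans hW'W, ?_, hD _ (d a).2⟩
        rw [Finset.card_erase_add_one (hDW (d a).2), hW']
      · simp only [if_neg hij]
        have := hg1 i (by omega) a
        exact ⟨this.1.trans (Finset.sdiff_subset.trans hW'W), this.2⟩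
    · intro i hi
      by_cases hij : i = j
      · subst hij
        simp only [if_true]
        intro a b hab
        exact d.injective (Subtype.ext (Finset.erase_injOn W' (hDW (d a).2) (hDW (d b).2) hab))
      · simp only [if_neg hij]
        exact hg2 i (by omega)
    · intro i i' hii hi' a b
      have hij : i ≠ j := by omega
      simp only [if_neg hij]
      by_cases hij' : i' = j
      · simp only [if_pos hij']
        exact hsub i (by omega) a b
      · simp only [if_neg hij']
        exact hg3 i i' hii (by omega) a b

theorem exists_upper_chain {N : ℕ} {E : Finset (Fin N) → Prop} {B e s k : ℕ}
    (hE : ∀ V : Finset (Fin N), V.Nonempty → #V ≤ s →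
        ∃ X : Finset (Fin N), #X = e ∧ ∀ x ∈ X, x ∉ V ∧ E (insert x V))
    (hB : 2 ≤ B) (hs : B + k * e ≤ s) (hN : s ≤ N) (d : ℕ) :
    ∀ i₀, i₀ + d = k → ∀ V : Finset (Fin N), (d = 0 ∨ #V < B + i₀ * e) →
      ∃ g : ℕ → Fin e → Finset (Fin N),
        (∀ i, i₀ ≤ i → i < k → ∀ a, V ⊆ g i a ∧ IsUpper E B e i (g i a)) ∧
        (∀ i, i₀ ≤ i → i < k → Function.Injective (g i)) ∧
        ∀ i i', i₀ ≤ i → i < i' → i' < k → ∀ a b, g i a ⊆ g i' b := by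
  classical
  induction d with
  | zero =>
    intro i₀ hi V _
    exact ⟨fun _ _ ↦ ∅, fun i h h' ↦ by omega, fun i h h' ↦ by omega, fun i i' h h' ↦ by omega⟩
  | succ d ih =>
    intro i₀ hi V hV
    have hV := hV.resolve_left (by omega)
    have hik : i₀ * e ≤ k * e := Nat.mul_le_mul_right _ (by omega)
    obtain ⟨V', hVV', -, hV'⟩ := Finset.exists_subsuperset_card_eq (Finset.subset_univ V)
      (n := B + i₀ * e - 1) (by omega) (by simp; omega)
    obtain ⟨X, hX, hXV⟩ := hE V' (Finset.card_pos.1 (by omega)) (by omega)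
    have hmul : (i₀ + 1) * e = i₀ * e + e := by ring
    obtain ⟨g, hg1, hg2, hg3⟩ := ih (i₀ + 1) (by omega) (V' ∪ X) (Or.inr (by
      have := Finset.card_union_le V' X
      omega))
    let x := (X.equivFinOfCardEq hX).symm
    have hsub : ∀ i, i₀ < i → i < k → ∀ a b, insert (x b : Fin N) V' ⊆ g i a := by
      intro i h1 h2 a b
      refine subset_trans ?_ (hg1 i h1 h2 a).1
      exact Finset.insert_subset (Finset.mem_union_right _ (x b).2) Finset.subset_union_left
    refine ⟨fun i a ↦ if i = i₀ then insert (x a : Fin N) V' else g i a, ?_, ?_, ?_⟩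
    · intro i h1 h2 a
      by_cases hij : i = i₀
      · subst hij
        simp only [if_true]
        refine ⟨hVV'.trans (Finset.subset_insert _ _), ?_, (hXV _ (x a).2).2⟩
        rw [Finset.card_insert_of_notMem (hXV _ (x a).2).1]; omega
      · simp only [if_neg hij]
        have := hg1 i (by omega) h2 a
        exact ⟨hVV'.trans (Finset.subset_union_left.trans this.1), this.2⟩
    · intro i h1 h2
      by_cases hij : i = i₀
      · subst hij
        simp only [if_true]
        intro a b hab
        have hmem : (x a : Fin N) ∈ insert (x b : Fin N) V' := by
          have hab' : insert (x a : Fin N) V' = insert (x b : Fin N) V' := hab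
          rw [← hab']
          exact Finset.mem_insert_self _ _
        refine x.injective (Subtype.ext ?_)
        exact (Finset.mem_insert.1 hmem).resolve_right (hXV _ (x a).2).1
      · simp only [if_neg hij]
        exact hg2 i (by omega) h2
    · intro i i' h1 hii h2 a b
      have hij' : i' ≠ i₀ := by omega
      simp only [if_neg hij']
      by_cases hij : i = i₀
      · simp only [if_pos hij]
        exact hsub i' (by omega) h2 b a
      · simp only [if_neg hij]
        exact hg3 i i' (by omega) hii h2 a b

theorem threshold_mono (B e : ℕ) {a b : ℕ} (h : a ≤ b) : B + a * e ≤ B + b * e :=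
  Nat.add_le_add_left (Nat.mul_le_mul_right _ h) _

theorem IsBase.card_ge {N n : ℕ} {ι : Fin N ↪ Fin n} {E : Finset (Fin N) → Prop} {B e k : ℕ}
    {S : Finset (Fin n)} (h : IsBase ι E B e k S) : 1 < k ∧ B + e ≤ #(tr ι S) + 1 := by
  rcases h with ⟨i, A, hi, hA, rfl⟩ | ⟨i, A, h1, hi, hA, rfl⟩
  · have := threshold_mono B e (show 1 ≤ i + 1 by omega)
    rw [tr_lowSet, hA.1]
    omega
  · have := threshold_mono B e h1
    rw [tr_upSet, hA.1]
    omega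

theorem IsBase.ext {N n : ℕ} {ι : Fin N ↪ Fin n} {E : Finset (Fin N) → Prop} {B e k : ℕ}
    (he : 2 ≤ e) {S T : Finset (Fin n)} (hS : IsBase ι E B e k S) (hT : IsBase ι E B e k T)
    (h : tr ι S = tr ι T) : S = T := by
  have key : ∀ i j A, IsLower E B e i A → IsUpper E B e j A → False := by
    intro i j A hA hA'
    have h1 := hA.1
    rw [hA'.1] at h1
    have h2 : (i + 1) * e = i * e + e := by ring
    rcases le_or_gt j i with hji | hji
    · have := threshold_mono B e hji
      omega
    · have := threshold_mono B e hji
      simp only [Nat.succ_eq_add_one] at this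
      omega
  rcases hS with ⟨i, A, hi, hA, rfl⟩ | ⟨i, A, h1, hi, hA, rfl⟩ <;>
  rcases hT with ⟨j, A', hj, hA', rfl⟩ | ⟨j, A', h1', hj, hA', rfl⟩ <;>
  simp only [tr_lowSet, tr_upSet] at h <;> subst h
  · rfl
  · exact (key _ _ _ hA hA').elim
  · exact (key _ _ _ hA' hA).elim
  · rfl

theorem add_one_le_card_union {α : Type*} [DecidableEq α] {A A' : Finset α} {c : ℕ} (hne : A ≠ A')
    (h : c ≤ #A + 1) (h' : c ≤ #A' + 1) : c ≤ #(A ∪ A') := by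
  by_contra! hlt
  have h1 := Finset.eq_of_subset_of_card_le (Finset.subset_union_left (s₁ := A) (s₂ := A'))
    (by omega)
  have h2 := Finset.eq_of_subset_of_card_le (Finset.subset_union_right (s₁ := A) (s₂ := A'))
    (by omega)
  exact hne (h1.trans h2.symm)

/-- A lower set and an upper set meeting in at least `B + i * e` elements have a union of size at
least `B + (i + 1) * e`. -/
theorem card_union_lower_upper {N : ℕ} {E : Finset (Fin N) → Prop} {B e i a b : ℕ} (he : 2 ≤ e)
    {A A' : Finset (Fin N)} (hA : IsLower E B e a A) (hA' : IsUpper E B e b A')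
    (h : B + i * e ≤ #(A ∩ A')) :
    i ≤ a ∧ B + (i + 1) * e ≤ #(A ∪ A') := by
  have hcA := hA.1
  have hcA' := hA'.1
  have i1 := Finset.card_le_card (Finset.inter_subset_left (s₁ := A) (s₂ := A'))
  have i2 := Finset.card_le_card (Finset.inter_subset_right (s₁ := A) (s₂ := A'))
  have u1 := Finset.card_le_card (Finset.subset_union_left (s₁ := A) (s₂ := A'))
  have u2 := Finset.card_le_card (Finset.subset_union_right (s₁ := A) (s₂ := A'))
  have m1 : (i + 1) * e = i * e + e := by ring
  have hia : i ≤ a := by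
    by_contra! hlt
    have := threshold_mono B e (show a + 1 ≤ i by omega)
    omega
  refine ⟨hia, ?_⟩
  have hib : i ≤ b := by
    by_contra! hlt
    have := threshold_mono B e (show b + 1 ≤ i by omega)
    have : (b + 1) * e = b * e + e := by ring
    omega
  rcases hib.lt_or_eq with hlt | rfl
  · have := threshold_mono B e (show i + 1 ≤ b by omega)
    omega
  rcases hia.lt_or_eq with hlt | rfl
  · have := threshold_mono B e (show i + 1 + 1 ≤ a + 1 by omega)
    have : (i + 1 + 1) * e = (i + 1) * e + e := by ring
    omega
  · exfalso
    have heq : A ∩ A' = A' := Finset.eq_of_subset_of_card_le Finset.inter_subset_right (by omega)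
    exact hA.2 A' (Finset.inter_eq_right.1 heq) hcA' hA'.2

theorem IsBase.step {N n : ℕ} {ι : Fin N ↪ Fin n} {E : Finset (Fin N) → Prop} {B e k i : ℕ}
    (he : 2 ≤ e) {S T : Finset (Fin n)} (hS : IsBase ι E B e k S) (hT : IsBase ι E B e k T)
    (hST : ¬ S ⊆ T) (hTS : ¬ T ⊆ S) (h : i = 0 ∨ B + i * e ≤ #(tr ι S ∩ tr ι T)) :
    i + 1 < k ∧ B + (i + 1) * e ≤ #(tr ι S ∪ tr ι T) := by
  have hne : tr ι S ≠ tr ι T := fun heq ↦ hST (hS.ext he hT heq).subset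
  rcases h with rfl | h
  · have h1 := hS.card_ge
    have h2 := hT.card_ge
    exact ⟨by omega, add_one_le_card_union hne (by omega) (by omega)⟩
  have i1 := Finset.card_le_card (Finset.inter_subset_left (s₁ := tr ι S) (s₂ := tr ι T))
  have i2 := Finset.card_le_card (Finset.inter_subset_right (s₁ := tr ι S) (s₂ := tr ι T))
  rcases hS with ⟨a, A, ha, hA, rfl⟩ | ⟨a, A, ha1, ha, hA, rfl⟩ <;>
  rcases hT with ⟨b, A', hb, hA', rfl⟩ | ⟨b, A', hb1, hb, hA', rfl⟩ <;>
  simp only [tr_lowSet, tr_upSet] at h hne i1 i2 ⊢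
  · have c1 := hA.1
    have c2 := hA'.1
    have hia : i ≤ a := by
      by_contra! hlt
      have := threshold_mono B e (show a + 1 ≤ i by omega)
      omega
    have hib : i ≤ b := by
      by_contra! hlt
      have := threshold_mono B e (show b + 1 ≤ i by omega)
      omega
    have t1 := threshold_mono B e (show i + 1 ≤ a + 1 by omega)
    have t2 := threshold_mono B e (show i + 1 ≤ b + 1 by omega)
    exact ⟨by omega, add_one_le_card_union hne (by omega) (by omega)⟩
  · have := card_union_lower_upper he hA hA' h
    exact ⟨by omega, this.2⟩
  · rw [Finset.inter_comm] at h
    rw [Finset.union_comm]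
    have := card_union_lower_upper he hA' hA h
    exact ⟨by omega, this.2⟩
  · rw [subset_upSet_iff, tr_upSet] at hST
    have hlt : #(A ∩ A') < #A := by
      refine Finset.card_lt_card (Finset.ssubset_iff_subset_ne.2 ⟨Finset.inter_subset_left, ?_⟩)
      exact fun heq ↦ hST (Finset.inter_eq_left.1 heq)
    have c1 := hA.1
    have hia : i + 1 ≤ a := by
      by_contra! hlt
      have := threshold_mono B e (show a ≤ i by omega)
      omega
    have t1 := threshold_mono B e hia
    have u1 := Finset.card_le_card (Finset.subset_union_left (s₁ := A) (s₂ := A'))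
    exact ⟨by omega, by omega⟩

theorem not_containsCopy_base {N n k : ℕ} {ι : Fin N ↪ Fin n} {E : Finset (Fin N) → Prop}
    {B e : ℕ} (he : 2 ≤ e) (hk : 1 ≤ k) {ns : Fin k → ℕ} (hns : ∀ i, 2 ≤ ns i)
    {𝒜 : Finset (Finset (Fin n))} (h𝒜 : ∀ S ∈ 𝒜, IsBase ι E B e k S) :
    ¬ ContainsCopy (KPoset ns) 𝒜 := by
  rintro ⟨f, -, hmem, hle⟩
  let x : (i : ℕ) → i < k → KPoset ns := fun i hi ↦ ⟨⟨i, hi⟩, ⟨0, by have := hns ⟨i, hi⟩; omega⟩⟩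
  let y : (i : ℕ) → i < k → KPoset ns := fun i hi ↦ ⟨⟨i, hi⟩, ⟨1, by have := hns ⟨i, hi⟩; omega⟩⟩
  have hincomp : ∀ i hi, ¬ f (x i hi) ⊆ f (y i hi) ∧ ¬ f (y i hi) ⊆ f (x i hi) := by
    intro i hi
    rw [← hle, ← hle]
    constructor <;> rintro (h | h)
    · simpa [x, y] using congrArg (fun z : KPoset ns ↦ z.2.val) h
    · exact lt_irrefl _ h
    · simpa [x, y] using congrArg (fun z : KPoset ns ↦ z.2.val) h
    · exact lt_irrefl _ h
  have main : ∀ i (hi : i < k),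
      i + 1 < k ∧ B + (i + 1) * e ≤ #(tr ι (f (x i hi)) ∪ tr ι (f (y i hi))) := by
    intro i
    induction i with
    | zero =>
      intro hi
      exact IsBase.step he (h𝒜 _ (hmem _)) (h𝒜 _ (hmem _)) (hincomp 0 hi).1 (hincomp 0 hi).2
        (Or.inl rfl)
    | succ i ih =>
      intro hi
      refine IsBase.step he (h𝒜 _ (hmem _)) (h𝒜 _ (hmem _)) (hincomp _ hi).1 (hincomp _ hi).2
        (Or.inr ((ih (by omega)).2.trans (Finset.card_le_card ?_)))
      have hlt : (⟨i, by omega⟩ : Fin k) < ⟨i + 1, hi⟩ := Nat.lt_succ_self i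
      refine Finset.union_subset (Finset.subset_inter ?_ ?_) (Finset.subset_inter ?_ ?_) <;>
        exact tr_mono ι ((hle _ _).1 (Or.inr hlt))
  have := (main (k - 1) (by omega)).1
  omega

theorem isInducedCopy_of_layers {k n : ℕ} {ns : Fin k → ℕ} {𝒜 : Finset (Finset (Fin n))}
    {f : KPoset ns → Finset (Fin n)} (hmem : ∀ x, f x ∈ 𝒜)
    (hlt : ∀ x y : KPoset ns, x.1 < y.1 → f x ⊂ f y)
    (heq : ∀ i a b, f ⟨i, a⟩ ⊆ f ⟨i, b⟩ → a = b) : IsInducedCopy 𝒜 f := by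
  have hle : ∀ x y : KPoset ns, x ≤ y ↔ f x ⊆ f y := by
    intro x y
    constructor
    · rintro (rfl | h)
      · exact subset_rfl
      · exact (hlt x y h).subset
    · intro h
      rcases lt_trichotomy x.1 y.1 with h1 | h1 | h1
      · exact Or.inr h1
      · obtain ⟨i, a⟩ := x
        obtain ⟨j, b⟩ := y
        simp only at h1
        subst h1
        obtain rfl := heq i a b h
        exact le_refl _
      · exact ((hlt y x h1).not_subset h).elim
  refine ⟨fun x y hxy ↦ le_antisymm ?_ ?_, hmem, hle⟩
  · rw [hle, hxy]
  · rw [hle, hxy]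

theorem exists_layer (B e k v : ℕ) (hk : 1 ≤ k) :
    ∃ l < k, (l = 0 ∨ B + l * e ≤ v) ∧ (k - (l + 1) = 0 ∨ v < B + (l + 1) * e) := by
  classical
  set P : ℕ → Prop := fun l ↦ l = 0 ∨ B + l * e ≤ v
  have h0 : P 0 := Or.inl rfl
  have hl := Nat.findGreatest_le (P := P) (k - 1)
  refine ⟨Nat.findGreatest P (k - 1), by omega, Nat.findGreatest_spec (Nat.zero_le _) h0, ?_⟩
  by_cases hk' : Nat.findGreatest P (k - 1) = k - 1
  · left; omega
  · right
    by_contra! hge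
    exact Nat.findGreatest_is_greatest (P := P) (n := k - 1) (Nat.lt_succ_self _)
      (by omega) (Or.inr hge)

/-- A family containing the base family and, within one trace and one cardinality, `e` sets,
contains a copy of every complete layered poset with `k` layers of sizes at most `e`. -/
theorem containsCopy_of_fiber {N n k : ℕ} {ι : Fin N ↪ Fin n} {E : Finset (Fin N) → Prop}
    {B e s : ℕ} (he : 2 ≤ e) (hk : 1 ≤ k) {ns : Fin k → ℕ} (hns : ∀ i, ns i ≤ e)
    (hup : ∀ V : Finset (Fin N), V.Nonempty → #V ≤ s →
        ∃ X : Finset (Fin N), #X = e ∧ ∀ x ∈ X, x ∉ V ∧ E (insert x V))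
    (hdown : ∀ (W : Finset (Fin N)) (p : ℕ), #W = p + e → (2 * e + 1) * (2 * e) + e ≤ #W →
        ∃ D ⊆ W, #D = e ∧ ∀ w ∈ D, ∀ U ⊆ W.erase w, #U = p → ¬ E U)
    (hB : (2 * e + 1) * (2 * e) ≤ B) (hs : B + k * e ≤ s) (hN : s ≤ N)
    {𝒜 : Finset (Finset (Fin n))} (h𝒜 : ∀ S, IsBase ι E B e k S → S ∈ 𝒜)
    (V : Finset (Fin N)) (c : ℕ) {𝒞 : Finset (Finset (Fin n))} (h𝒞 : 𝒞 ⊆ 𝒜) (h𝒞e : #𝒞 = e)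
    (hfib : ∀ S ∈ 𝒞, tr ι S = V ∧ #S = c) : ContainsCopy (KPoset ns) 𝒜 := by
  classical
  obtain ⟨l, hlk, hl1, hl2⟩ := exists_layer B e k #V hk
  have hB2 : 2 ≤ B := by
    have : 1 * 4 ≤ (2 * e + 1) * (2 * e) := Nat.mul_le_mul (by omega) (by omega)
    omega
  obtain ⟨g, hg1, hg2, hg3⟩ := exists_lower_chain hdown hB l V hl1
  obtain ⟨h, hh1, hh2, hh3⟩ := exists_upper_chain (k := k) hup hB2 hs hN
    (k - (l + 1)) (l + 1) (by omega) V hl2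
  let S := (𝒞.equivFinOfCardEq h𝒞e).symm
  let F : ℕ → Fin e → Finset (Fin n) := fun i a ↦
    if i < l then lowSet ι (g i a) else if i = l then S a else upSet ι (h i a)
  have F1 : ∀ i a, i < l → F i a = lowSet ι (g i a) := fun i a hi ↦ if_pos hi
  have F2 : ∀ a, F l a = S a := fun a ↦ by simp [F]
  have F3 : ∀ i a, l < i → F i a = upSet ι (h i a) := fun i a hi ↦ by
    simp only [F]; rw [if_neg (by omega), if_neg (by omega)]
  have hcard : ∀ i j, i < j → j < k → ∀ a b, #(tr ι (F i a)) < #(tr ι (F j b)) := by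
    intro i j hij hjk a b
    have hS : ∀ a, tr ι (S a) = V := fun a ↦ (hfib _ (S a).2).1
    rcases lt_trichotomy j l with hj | rfl | hj
    · rw [F1 i a (by omega), F1 j b hj, tr_lowSet, tr_lowSet]
      have c1 := (hg1 i (by omega) a).2.1
      have c2 := (hg1 j hj b).2.1
      have := threshold_mono B e (show i + 1 ≤ j by omega)
      have : (j + 1) * e = j * e + e := by ring
      omega
    · rw [F1 i a hij, F2, tr_lowSet, hS]
      have c1 := (hg1 i hij a).2.1
      have := threshold_mono B e (show i + 1 ≤ j by omega)
      omega
    · rw [F3 j b hj, tr_upSet]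
      have c2 := (hh1 j hj hjk b).2.1
      have := threshold_mono B e (show l + 1 ≤ j by omega)
      rcases lt_trichotomy i l with hi | rfl | hi
      · rw [F1 i a hi, tr_lowSet]
        have c1 := (hg1 i hi a).2.1
        have := threshold_mono B e (show i + 1 ≤ j by omega)
        omega
      · rw [F2, hS]
        omega
      · rw [F3 i a hi, tr_upSet]
        have c1 := (hh1 i hi (by omega) a).2.1
        have := threshold_mono B e (show i + 1 ≤ j by omega)
        have : (i + 1) * e = i * e + e := by ring
        omega
  have hsub : ∀ i j, i < j → j < k → ∀ a b, F i a ⊆ F j b := by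
    intro i j hij hjk a b
    have hS : ∀ a, tr ι (S a) = V := fun a ↦ (hfib _ (S a).2).1
    rcases lt_trichotomy j l with hj | rfl | hj
    · rw [F1 i a (by omega), F1 j b hj, lowSet_subset_iff, tr_lowSet]
      exact hg3 i j hij hj a b
    · rw [F1 i a hij, F2, lowSet_subset_iff, hS]
      exact (hg1 i hij a).1
    · rw [F3 j b hj, subset_upSet_iff]
      rcases lt_trichotomy i l with hi | rfl | hi
      · rw [F1 i a hi, tr_lowSet]
        exact (hg1 i hi a).1.trans (hh1 j hj hjk b).1
      · rw [F2, hS]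
        exact (hh1 j hj hjk b).1
      · rw [F3 i a hi, tr_upSet]
        exact hh3 i j hi hij hjk a b
  have hanti : ∀ i, i < k → ∀ a b, F i a ⊆ F i b → a = b := by
    intro i hik a b hab
    rcases lt_trichotomy i l with hi | rfl | hi
    · rw [F1 i a hi, F1 i b hi, lowSet_subset_iff, tr_lowSet] at hab
      have c1 := (hg1 i hi a).2.1
      have c2 := (hg1 i hi b).2.1
      exact hg2 i hi (Finset.eq_of_subset_of_card_le hab (by omega))
    · rw [F2, F2] at hab
      refine S.injective (Subtype.ext (Finset.eq_of_subset_of_card_le hab ?_))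
      rw [(hfib _ (S a).2).2, (hfib _ (S b).2).2]
    · rw [F3 i a hi, F3 i b hi, subset_upSet_iff, tr_upSet] at hab
      have c1 := (hh1 i hi hik a).2.1
      have c2 := (hh1 i hi hik b).2.1
      exact hh2 i hi hik (Finset.eq_of_subset_of_card_le hab (by omega))
  have hmem : ∀ i, i < k → ∀ a, F i a ∈ 𝒜 := by
    intro i hik a
    rcases lt_trichotomy i l with hi | rfl | hi
    · rw [F1 i a hi]
      exact h𝒜 _ (Or.inl ⟨i, _, by omega, (hg1 i hi a).2, rfl⟩)
    · rw [F2]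
      exact h𝒞 (S a).2
    · rw [F3 i a hi]
      exact h𝒜 _ (Or.inr ⟨i, _, by omega, hik, (hh1 i hi hik a).2, rfl⟩)
  refine ⟨fun x ↦ F x.1 (Fin.castLE (hns x.1) x.2), isInducedCopy_of_layers ?_ ?_ ?_⟩
  · exact fun x ↦ hmem _ x.1.2 _
  · intro x y hxy
    refine Finset.ssubset_iff_subset_ne.2 ⟨hsub _ _ hxy y.1.2 _ _, fun heq ↦ ?_⟩
    have := hcard _ _ hxy y.1.2 (Fin.castLE (hns x.1) x.2) (Fin.castLE (hns y.1) y.2)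
    rw [heq] at this
    exact lt_irrefl _ this
  · intro i a b hab
    exact Fin.castLE_injective (hns i) (hanti i i.2 _ _ hab)

/-- A copy-free family all of whose copy-free extensions are small bounds the saturation number. -/
theorem satStar_le_of_forall_extension {α : Type*} [PartialOrder α] {n m : ℕ}
    {𝒜 : Finset (Finset (Fin n))} (h𝒜 : ¬ ContainsCopy α 𝒜)
    (hm : ∀ ℬ, 𝒜 ⊆ ℬ → ¬ ContainsCopy α ℬ → #ℬ ≤ m) : satStar α n ≤ m := by
  obtain ⟨ℬ, h𝒜ℬ, hℬ⟩ := (Set.toFinite {ℬ : Finset (Finset (Fin n)) |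
    ¬ ContainsCopy α ℬ}).exists_le_maximal h𝒜
  have hsat : IsSaturatedFamily α ℬ := ⟨hℬ.prop, fun S hS ↦ by
    by_contra hno
    exact hS (hℬ.le_of_ge hno (Finset.subset_insert S ℬ) (Finset.mem_insert_self S ℬ))⟩
  have h1 : satStar α n ≤ #ℬ := Nat.sInf_le ⟨ℬ, hsat, rfl⟩
  exact h1.trans (hm ℬ h𝒜ℬ hℬ.prop)

/-- If `k ≥ 1` and `n₁, …, n_k ≥ 2`, then
`sat*(n, K_{n₁,…,n_k}) = O(n)`: there is a constant `C` (depending only on the layer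
sizes) with `sat*(n, K_{n₁,…,n_k}) ≤ C * n` for all sufficiently large `n`. -/
theorem statement12 (k : ℕ) (hk : 1 ≤ k) (ns : Fin k → ℕ) (hns : ∀ i, 2 ≤ ns i) :
    ∃ C N : ℕ, ∀ n ≥ N, satStar (KPoset ns) n ≤ C * n := by
  classical
  set e := Finset.univ.sup ns with he_def
  have hle : ∀ i, ns i ≤ e := fun i ↦ Finset.le_sup (Finset.mem_univ i)
  have he : 2 ≤ e := (hns ⟨0, hk⟩).trans (hle _)
  set B := (2 * e + 1) * (2 * e)
  obtain ⟨N, E, hpos, hup, hdown⟩ := exists_hypergraph (B + k * e) e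
  have hN : B + k * e ≤ N := by
    by_contra! hlt
    have hc : #(Finset.univ : Finset (Fin N)) = N := by simp
    have : NeZero N := ⟨(hpos (by omega)).ne'⟩
    obtain ⟨X, hX, hXV⟩ := hup Finset.univ Finset.univ_nonempty (by omega)
    obtain ⟨x, hx⟩ := Finset.card_pos.1 (show 0 < #X by omega)
    exact (hXV x hx).1 (Finset.mem_univ x)
  refine ⟨e * (2 ^ N * 2), N + 1, fun n hn ↦ ?_⟩
  let ι : Fin N ↪ Fin n := Fin.castLEEmb (by omega)
  refine satStar_le_of_forall_extension (𝒜 := Finset.univ.filter (IsBase ι E B e k))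
    (not_containsCopy_base he hk hns fun S hS ↦ (Finset.mem_filter.1 hS).2) fun ℬ hℬ hfree ↦ ?_
  have hfiber : ∀ z ∈ ℬ.image (fun S ↦ (tr ι S, #S)),
      #(ℬ.filter fun S ↦ (tr ι S, #S) = z) ≤ e := by
    rintro ⟨V, c⟩ -
    by_contra! hlt
    obtain ⟨𝒞, h𝒞, h𝒞e⟩ := Finset.exists_subset_card_eq hlt.le
    refine hfree (containsCopy_of_fiber he hk hle hup hdown le_rfl le_rfl hN
      (fun S hS ↦ hℬ (Finset.mem_filter.2 ⟨Finset.mem_univ S, hS⟩)) V c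
      (h𝒞.trans (Finset.filter_subset _ _)) h𝒞e fun S hS ↦ ?_)
    exact Prod.mk.inj (Finset.mem_filter.1 (h𝒞 hS)).2
  have himage : #(ℬ.image fun S ↦ (tr ι S, #S)) ≤ 2 ^ N * (n + 1) := by
    calc _ ≤ #((Finset.univ : Finset (Finset (Fin N))) ×ˢ Finset.range (n + 1)) := by
          refine Finset.card_le_card fun z hz ↦ ?_
          obtain ⟨S, -, rfl⟩ := Finset.mem_image.1 hz
          have := Finset.card_le_univ S
          rw [Fintype.card_fin] at this
          simp only [Finset.mem_product, Finset.mem_univ, Finset.mem_range, true_and]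
          omega
      _ = 2 ^ N * (n + 1) := by simp
  calc #ℬ ≤ e * #(ℬ.image fun S ↦ (tr ι S, #S)) := Finset.card_le_mul_card_image _ _ hfiber
    _ ≤ e * (2 ^ N * (n + 1)) := Nat.mul_le_mul_left _ himage
    _ ≤ e * (2 ^ N * (2 * n)) := by gcongr; omega
    _ = e * (2 ^ N * 2) * n := by ring
end

section
/- Let k ≥ 2 and let n1, ..., nk be positive integers such that there is no index i with ni = n_{i+1} = 1 (no two consecutive layers of size 1). Then sat*(n, K_{n1,...,nk}) = O(n); that is, there exists a constant C (depending only on n1, ..., nk) such that sat*(n, K_{n1,...,nk}) ≤ C · n for all sufficiently large n. -/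
open Finset Filter

/-- A pair of families `L`, `U` of subsets of `X` that realises an antichain layer of size `n`
on the range of cardinalities `[q', q)`. -/
structure Gadget {X : Type} [Fintype X] [DecidableEq X] (n q' q : ℕ) (L U : Set (Finset X)) :
    Prop where
  low_size : ∀ l ∈ L, q' ≤ l.card ∧ l.card ≤ q
  up_size : ∀ u ∈ U, q' ≤ u.card + 1 ∧ u.card + 1 ≤ q
  down : ∀ z : Finset X, q ≤ z.card → ∃ (f : Fin n → Finset X) (d : Finset X),
    (∀ a, f a ∈ L ∧ f a ⊆ z ∧ d ⊆ f a) ∧ (∀ a b, a ≠ b → ¬ f a ⊆ f b) ∧ q' ≤ d.card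
  up : ∀ z : Finset X, z.card < q' → ∃ (f : Fin n → Finset X) (w : Finset X),
    (∀ a, f a ∈ U ∧ z ⊆ f a ∧ f a ⊆ w) ∧ (∀ a b, a ≠ b → ¬ f a ⊆ f b) ∧ w.card < q
  free : ∀ (f : Fin n → Finset X) (low : Fin n → Prop) (d w : Finset X),
    (∀ a, low a → f a ∈ L) → (∀ a, ¬ low a → f a ∈ U) →
    (∀ a b, a ≠ b → ¬ (f a ⊆ f b ∧ (low a ∨ ¬ low b))) →
    (∀ a, d ⊆ f a) → (∀ a, f a ⊆ w) → q' ≤ d.card → q ≤ w.card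

section Gadgets

variable {X : Type} [DecidableEq X]

lemma exists_erase_family {n : ℕ} {z G : Finset X} (hG : G ⊆ z) (hn : n ≤ G.card) :
    ∃ (f : Fin n → Finset X) (d : Finset X), (∀ a, ∃ x ∈ G, f a = z.erase x) ∧
      (∀ a, d ⊆ f a) ∧ (∀ a b, a ≠ b → ¬ f a ⊆ f b) ∧ z.card ≤ d.card + n := by
  obtain ⟨T, hTG, hT⟩ := Finset.exists_subset_card_eq hn
  let e := (T.equivFinOfCardEq hT).symm
  refine ⟨fun a => z.erase (e a), z \ T, fun a => ⟨e a, hTG (e a).2, rfl⟩, ?_, ?_, ?_⟩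
  · intro a x hx
    rw [Finset.mem_sdiff] at hx
    refine Finset.mem_erase.2 ⟨?_, hx.1⟩
    rintro rfl
    exact hx.2 (e a).2
  · intro a b hab h
    have h1 : (e b : X) ∈ z.erase (e a) := by
      refine Finset.mem_erase.2 ⟨?_, hG (hTG (e b).2)⟩
      intro h2
      exact hab (e.injective (Subtype.ext h2)).symm
    exact (Finset.mem_erase.1 (h h1)).1 rfl
  · have := Finset.le_card_sdiff T z
    omega

lemma exists_insert_family {n : ℕ} {z G : Finset X} (hG : Disjoint G z) (hn : n ≤ G.card) :
    ∃ (f : Fin n → Finset X) (w : Finset X), (∀ a, ∃ x ∈ G, f a = insert x z) ∧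
      (∀ a, f a ⊆ w) ∧ (∀ a b, a ≠ b → ¬ f a ⊆ f b) ∧ w.card ≤ z.card + n := by
  obtain ⟨T, hTG, hT⟩ := Finset.exists_subset_card_eq hn
  let e := (T.equivFinOfCardEq hT).symm
  refine ⟨fun a => insert (e a : X) z, z ∪ T, fun a => ⟨e a, hTG (e a).2, rfl⟩, ?_, ?_, ?_⟩
  · intro a
    exact Finset.insert_subset (Finset.mem_union_right _ (e a).2) Finset.subset_union_left
  · intro a b hab h
    rcases Finset.mem_insert.1 (h (Finset.mem_insert_self _ _)) with h1 | h1
    · exact hab (e.injective (Subtype.ext h1))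
    · exact Finset.disjoint_left.1 hG (hTG (e a).2) h1
  · have := Finset.card_union_le z T
    omega

lemma free_of_card {n q' q : ℕ} {L U : Set (Finset X)} (hn : 2 ≤ n)
    (hL : ∀ l ∈ L, l.card + 1 = q)
    (hU : ∀ u ∈ U, ∀ u' ∈ U, u ≠ u' → (u ∩ u').card < q')
    (h2 : n = 2 → ∀ l ∈ L, ∀ u ∈ U, ¬ u ⊆ l)
    (f : Fin n → Finset X) (low : Fin n → Prop) (d w : Finset X)
    (hl : ∀ a, low a → f a ∈ L) (hu : ∀ a, ¬ low a → f a ∈ U)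
    (hanti : ∀ a b, a ≠ b → ¬ (f a ⊆ f b ∧ (low a ∨ ¬ low b)))
    (hd : ∀ a, d ⊆ f a) (hw : ∀ a, f a ⊆ w) (hdq : q' ≤ d.card) : q ≤ w.card := by
  by_contra! hlt
  have hlw : ∀ a, low a → f a = w := fun a ha =>
    Finset.eq_of_subset_of_card_le (hw a) (by have := hL _ (hl a ha); omega)
  have hll : ∀ a b, a ≠ b → low a → low b → False := fun a b hab ha hb =>
    hanti a b hab ⟨by rw [hlw a ha, hlw b hb], Or.inl ha⟩
  have huu : ∀ a b, a ≠ b → ¬ low a → ¬ low b → False := by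
    intro a b hab ha hb
    have hne : f a ≠ f b := fun h => hanti a b hab ⟨h.subset, Or.inr hb⟩
    have h1 := hU _ (hu a ha) _ (hu b hb) hne
    have h3 := Finset.card_le_card (Finset.subset_inter (hd a) (hd b))
    omega
  have hlu : ∀ a b, low a → ¬ low b → n ≠ 2 := fun a b ha hb hn2 =>
    h2 hn2 _ (hl a ha) _ (hu b hb) (by rw [hlw a ha]; exact hw b)
  have h01 : (⟨0, by omega⟩ : Fin n) ≠ ⟨1, by omega⟩ := by simp
  have hn2 : n ≠ 2 := by
    by_cases h0 : low ⟨0, by omega⟩ <;> by_cases h1 : low ⟨1, by omega⟩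
    · exact (hll _ _ h01 h0 h1).elim
    · exact hlu _ _ h0 h1
    · exact hlu _ _ h1 h0
    · exact (huu _ _ h01 h0 h1).elim
  have h02 : (⟨0, by omega⟩ : Fin n) ≠ ⟨2, by omega⟩ := by simp
  have h12 : (⟨1, by omega⟩ : Fin n) ≠ ⟨2, by omega⟩ := by simp
  by_cases h0 : low ⟨0, by omega⟩ <;> by_cases h1 : low ⟨1, by omega⟩ <;>
    by_cases h2 : low ⟨2, by omega⟩
  all_goals first
    | exact hll _ _ h01 h0 h1
    | exact hll _ _ h02 h0 h2
    | exact hll _ _ h12 h1 h2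
    | exact huu _ _ h01 h0 h1
    | exact huu _ _ h02 h0 h2
    | exact huu _ _ h12 h1 h2

lemma exists_down_family {n q' q : ℕ} (hq : q' + n ≤ q) (z : Finset X) (hz : q ≤ z.card) :
    ∃ (f : Fin n → Finset X) (d : Finset X),
      (∀ a, f a ∈ {l : Finset X | l.card + 1 = q} ∧ f a ⊆ z ∧ d ⊆ f a) ∧
      (∀ a b, a ≠ b → ¬ f a ⊆ f b) ∧ q' ≤ d.card := by
  obtain ⟨z₀, hz₀, hc⟩ := Finset.exists_subset_card_eq hz
  obtain ⟨f, d, hf, hd, hanti, hcard⟩ :=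
    exists_erase_family (Finset.Subset.refl z₀) (n := n) (by omega)
  refine ⟨f, d, fun a => ⟨?_, ?_, hd a⟩, hanti, by omega⟩
  · obtain ⟨x, hx, hfa⟩ := hf a
    rw [Set.mem_ofPred_eq, hfa, Finset.card_erase_add_one hx, hc]
  · obtain ⟨x, hx, hfa⟩ := hf a
    rw [hfa]
    exact (Finset.erase_subset _ _).trans hz₀

lemma inter_card_lt_of_ne {q : ℕ} {u u' : Finset X} (hu : u.card = q) (hu' : u'.card = q)
    (hne : u ≠ u') : (u ∩ u').card < q := by
  by_contra! h
  refine hne (Finset.eq_of_subset_of_card_le ?_ (by omega))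
  rw [← Finset.inter_eq_left]
  exact Finset.eq_of_subset_of_card_le Finset.inter_subset_left (by omega)

variable [Fintype X]

lemma exists_up_family {n q' q : ℕ} (hX : q' + n ≤ Fintype.card X + 1) (hq : q' + n ≤ q)
    (z : Finset X) (hz : z.card < q') :
    ∃ (f : Fin n → Finset X) (w : Finset X),
      (∀ a, f a ∈ {u : Finset X | u.card = q'} ∧ z ⊆ f a ∧ f a ⊆ w) ∧
      (∀ a b, a ≠ b → ¬ f a ⊆ f b) ∧ w.card < q := by
  obtain ⟨z₀, hz₀, -, hc⟩ := Finset.exists_subsuperset_card_eq (Finset.subset_univ z)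
    (n := q' - 1) (by omega) (by rw [Finset.card_univ]; omega)
  obtain ⟨f, w, hf, hw, hanti, hcard⟩ :=
    exists_insert_family (z := z₀) (G := z₀ᶜ) disjoint_compl_left (n := n)
      (by rw [Finset.card_compl]; omega)
  refine ⟨f, w, fun a => ⟨?_, ?_, hw a⟩, hanti, by omega⟩
  · obtain ⟨x, hx, hfa⟩ := hf a
    rw [Set.mem_ofPred_eq, hfa, Finset.card_insert_of_notMem (Finset.mem_compl.1 hx), hc]
    omega
  · obtain ⟨x, hx, hfa⟩ := hf a
    rw [hfa]
    exact hz₀.trans (Finset.subset_insert _ _)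

lemma gadget_one {q : ℕ} (hq : q ≤ Fintype.card X + 1) :
    Gadget 1 q q {l : Finset X | l.card = q} {u : Finset X | u.card + 1 = q} where
  low_size l hl := ⟨hl.ge, hl.le⟩
  up_size u hu := ⟨hu.ge, hu.le⟩
  down z hz := by
    obtain ⟨z₀, hz₀, hc⟩ := Finset.exists_subset_card_eq hz
    exact ⟨fun _ => z₀, z₀, fun _ => ⟨hc, hz₀, subset_rfl⟩,
      fun a b hab => (hab (Subsingleton.elim a b)).elim, hc.ge⟩
  up z hz := by
    obtain ⟨z₀, hz₀, -, hc⟩ := Finset.exists_subsuperset_card_eq (Finset.subset_univ z)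
      (n := q - 1) (by omega) (by rw [Finset.card_univ]; omega)
    exact ⟨fun _ => z₀, z₀, fun _ => ⟨show z₀.card + 1 = q by omega, hz₀, subset_rfl⟩,
      fun a b hab => (hab (Subsingleton.elim a b)).elim, by omega⟩
  free f low d w _ _ _ hd hw hq := hq.trans (Finset.card_le_card ((hd 0).trans (hw 0)))

lemma gadget_bottom {n q : ℕ} (hn : 2 ≤ n) (hq : n ≤ q) :
    Gadget n 0 q {l : Finset X | l.card + 1 = q} ∅ where
  low_size l hl := ⟨by omega, by rw [Set.mem_ofPred_eq] at hl; omega⟩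
  up_size u hu := hu.elim
  down z hz := exists_down_family (by omega) z hz
  up z hz := by omega
  free := free_of_card hn (fun l hl => hl) (fun u hu => hu.elim) (fun _ l _ u hu => hu.elim)

lemma gadget_top {n q' : ℕ} (hn : 2 ≤ n) (hq : q' + n ≤ Fintype.card X + 1) :
    Gadget n q' (Fintype.card X + 1) ∅ {u : Finset X | u.card = q'} where
  low_size l hl := hl.elim
  up_size u hu := by rw [Set.mem_ofPred_eq] at hu; omega
  down z hz := by have := Finset.card_le_univ z; omega
  up z hz := exists_up_family hq hq z hz
  free := free_of_card hn (fun l hl => hl.elim)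
    (fun u hu u' hu' hne => inter_card_lt_of_ne hu hu' hne) (fun _ l hl => hl.elim)

lemma gadget_three {n q' q : ℕ} (hn : 3 ≤ n) (hX : q' + n ≤ Fintype.card X + 1)
    (hq : q' + n ≤ q) :
    Gadget n q' q {l : Finset X | l.card + 1 = q} {u : Finset X | u.card = q'} where
  low_size l hl := by rw [Set.mem_ofPred_eq] at hl; omega
  up_size u hu := by rw [Set.mem_ofPred_eq] at hu; omega
  down z hz := exists_down_family hq z hz
  up z hz := exists_up_family hX hq z hz
  free := free_of_card (by omega) (fun l hl => hl)
    (fun u hu u' hu' hne => inter_card_lt_of_ne hu hu' hne) (by omega)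

/-- A family of blocks of size `t + s`, pairwise meeting in at most `t` points, such that every
`t`-set lies in two blocks meeting exactly in that set. -/
structure IsBlockSystem (t s : ℕ) (𝓑 : Set (Finset X)) : Prop where
  card_eq : ∀ B ∈ 𝓑, B.card = t + s
  inter_le : ∀ B ∈ 𝓑, ∀ B' ∈ 𝓑, B ≠ B' → (B ∩ B').card ≤ t
  cover : ∀ d : Finset X, d.card = t → ∃ B ∈ 𝓑, ∃ B' ∈ 𝓑, B ≠ B' ∧ d ⊆ B ∧ d ⊆ B'

lemma IsBlockSystem.exists_common {t s : ℕ} {𝓑 : Set (Finset X)} (h : IsBlockSystem t s 𝓑)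
    (ht : 3 ≤ t) (hs : t + 2 ≤ s) {z : Finset X} (hz : z.card = t + 2 * s + 1) :
    ∃ G ⊆ z, 2 ≤ G.card ∧ ∀ B ∈ 𝓑, B ⊆ z → G ⊆ B := by
  by_cases h0 : ∃ B ∈ 𝓑, B ⊆ z
  swap
  · push Not at h0
    exact ⟨z, subset_rfl, by omega, fun B hB hBz => (h0 B hB hBz).elim⟩
  obtain ⟨B, hB, hBz⟩ := h0
  by_cases h1 : ∃ B' ∈ 𝓑, B' ⊆ z ∧ B ≠ B'
  swap
  · push Not at h1
    refine ⟨B, hBz, by have := h.card_eq B hB; omega, fun B' hB' hBz' => ?_⟩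
    rw [h1 B' hB' hBz']
  obtain ⟨B', hB', hBz', hne⟩ := h1
  have hc := Finset.card_union_add_card_inter B B'
  have hcB := h.card_eq B hB
  have hcB' := h.card_eq B' hB'
  have hu := Finset.card_le_card (Finset.union_subset hBz hBz')
  refine ⟨B ∩ B', Finset.inter_subset_left.trans hBz, by omega, fun B'' hB'' hBz'' => ?_⟩
  by_cases e1 : B = B''
  · rw [← e1]; exact Finset.inter_subset_left
  by_cases e2 : B' = B''
  · rw [← e2]; exact Finset.inter_subset_right
  exfalso
  have hcB'' := h.card_eq B'' hB''
  have i1 := h.inter_le B hB B' hB' hne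
  have i2 := h.inter_le B hB B'' hB'' e1
  have i3 := h.inter_le B' hB' B'' hB'' e2
  have hc2 := Finset.card_union_add_card_inter (B ∪ B') B''
  have hu2 := Finset.card_le_card (Finset.union_subset (Finset.union_subset hBz hBz') hBz'')
  rw [Finset.union_inter_distrib_right] at hc2
  have := Finset.card_union_le (B ∩ B'') (B' ∩ B'')
  omega

lemma gadget_two {t s : ℕ} {𝓑 : Set (Finset X)} (h : IsBlockSystem t s 𝓑) (ht : 3 ≤ t)
    (hs : t + 2 ≤ s) (hX : t ≤ Fintype.card X) :
    Gadget 2 (t + 1) (t + 2 * s + 1)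
      {l : Finset X | l.card + 1 = t + 2 * s + 1 ∧ ∀ B ∈ 𝓑, ¬ B ⊆ l} 𝓑 where
  low_size l hl := by have := hl.1; omega
  up_size u hu := by have := h.card_eq u hu; omega
  down z hz := by
    obtain ⟨z₀, hz₀, hc⟩ := Finset.exists_subset_card_eq hz
    obtain ⟨G, hGz, hG, hGB⟩ := h.exists_common ht hs hc
    obtain ⟨f, d, hf, hd, hanti, hcard⟩ := exists_erase_family hGz hG
    refine ⟨f, d, fun a => ⟨⟨?_, ?_⟩, ?_, hd a⟩, hanti, by omega⟩
    all_goals obtain ⟨x, hx, hfa⟩ := hf a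
    · rw [hfa, Finset.card_erase_add_one (hGz hx), hc]
    · intro B hB hBf
      rw [hfa] at hBf
      exact (Finset.mem_erase.1 (hBf (hGB B hB (hBf.trans (Finset.erase_subset _ _)) hx))).1 rfl
    · rw [hfa]
      exact (Finset.erase_subset _ _).trans hz₀
  up z hz := by
    obtain ⟨d, hzd, -, hc⟩ := Finset.exists_subsuperset_card_eq (Finset.subset_univ z)
      (n := t) (by omega) (by rw [Finset.card_univ]; omega)
    obtain ⟨B, hB, B', hB', hne, hdB, hdB'⟩ := h.cover d hc
    have c1 := h.card_eq B hB
    have c2 := h.card_eq B' hB'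
    refine ⟨![B, B'], B ∪ B', ?_, ?_, ?_⟩
    · rw [Fin.forall_fin_two]
      exact ⟨⟨hB, hzd.trans hdB, Finset.subset_union_left⟩,
        ⟨hB', hzd.trans hdB', Finset.subset_union_right⟩⟩
    · rw [Fin.forall_fin_two, Fin.forall_fin_two, Fin.forall_fin_two]
      refine ⟨⟨fun h => (h rfl).elim, fun _ hs => ?_⟩, ⟨fun _ hs => ?_, fun h => (h rfl).elim⟩⟩
      · exact hne (Finset.eq_of_subset_of_card_le hs (by simp [c1, c2]))
      · exact hne (Finset.eq_of_subset_of_card_le hs (by simp [c1, c2])).symm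
    · have := Finset.card_union_add_card_inter B B'
      have := Finset.card_le_card (Finset.subset_inter hdB hdB')
      omega
  free := free_of_card le_rfl (fun l hl => hl.1)
    (fun u hu u' hu' hne => by have := h.inter_le u hu u' hu' hne; omega)
    (fun _ l hl u hu => hl.2 u hu)

end Gadgets
/-- For every `K` there is a finite asymmetric relation in which any `K` elements have a common
dominating element. -/
lemma exists_dominating_relation (K : ℕ) :
    ∃ (V : Type) (_ : Fintype V) (_ : DecidableEq V) (R : V → V → Prop),
      (∀ x y, R x y → ¬ R y x) ∧
      ∀ D : Finset V, D.card ≤ K → ∃ v, ∀ x ∈ D, R v x := by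
  classical
  refine ⟨Fin (K * K + 1) × {S : Finset (Fin (K * K + 1)) // S.card ≤ K}, inferInstance,
    inferInstance, fun x y => y.1 ∈ x.2.1 ∧ x.1 ∉ y.2.1, fun x y h h' => h.2 h'.1, ?_⟩
  intro D hD
  have hcard : (D.biUnion fun x => x.2.1).card < (univ : Finset (Fin (K * K + 1))).card := by
    rw [Finset.card_univ, Fintype.card_fin]
    have h1 := Finset.card_biUnion_le_card_mul D (fun x => x.2.1) K (fun x _ => x.2.2)
    have h2 := Nat.mul_le_mul_right K hD
    omega
  obtain ⟨i, -, hi⟩ := Finset.exists_mem_notMem_of_card_lt_card hcard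
  refine ⟨(i, ⟨D.image Prod.fst, Finset.card_image_le.trans hD⟩), fun x hx => ⟨?_, ?_⟩⟩
  · exact Finset.mem_image_of_mem _ hx
  · intro h
    exact hi (Finset.mem_biUnion.2 ⟨x, hx, h⟩)

/-- Greedy choice: pairwise constraints can be satisfied simultaneously when every index excludes
fewer values than there are. -/
lemma exists_greedy_assignment {ι W : Type*} [DecidableEq ι] [Fintype W] [Nonempty W]
    (ok : ι → ι → W → W → Prop) (hsymm : ∀ i j w w', ok i j w w' → ok j i w' w)
    (c : ι → ι → ℕ) (hc : ∀ i j w', i ≠ j → ∃ T : Finset W, T.card ≤ c i j ∧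
      ∀ w, ¬ ok i j w w' → w ∈ T)
    (I : Finset ι) (hI : ∀ i ∈ I, ∑ j ∈ I, c i j < Fintype.card W) :
    ∃ f : ι → W, ∀ i ∈ I, ∀ j ∈ I, i ≠ j → ok i j (f i) (f j) := by
  classical
  suffices h : ∀ J ⊆ I, ∃ f : ι → W, ∀ i ∈ J, ∀ j ∈ J, i ≠ j → ok i j (f i) (f j) from
    h I subset_rfl
  intro J
  induction J using Finset.induction_on with
  | empty => exact fun _ => ⟨fun _ => Classical.arbitrary W, by simp⟩
  | insert i J hiJ ih =>
    intro hJ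
    obtain ⟨f, hf⟩ := ih ((Finset.subset_insert _ _).trans hJ)
    have hne : ∀ j ∈ J, i ≠ j := fun j hj h => hiJ (h ▸ hj)
    choose! T hT hT' using fun j (hj : i ≠ j) => hc i j (f j) hj
    have hcard : (J.biUnion T).card < (univ : Finset W).card := by
      refine lt_of_le_of_lt ?_ (hI i (hJ (Finset.mem_insert_self _ _)))
      refine Finset.card_biUnion_le.trans ((Finset.sum_le_sum fun j hj => hT j (hne j hj)).trans ?_)
      exact Finset.sum_le_sum_of_subset ((Finset.subset_insert _ _).trans hJ)
    obtain ⟨w, -, hw⟩ := Finset.exists_mem_notMem_of_card_lt_card hcard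
    have key : ∀ j ∈ J, ok i j w (f j) := by
      intro j hj
      by_contra h
      exact hw (Finset.mem_biUnion.2 ⟨j, hj, hT' j (hne j hj) w h⟩)
    refine ⟨Function.update f i w, fun a ha b hb hab => ?_⟩
    rw [Finset.mem_insert] at ha hb
    rcases ha with rfl | ha <;> rcases hb with rfl | hb
    · exact (hab rfl).elim
    · rw [Function.update_self, Function.update_of_ne (hne b hb).symm]
      exact key b hb
    · rw [Function.update_self, Function.update_of_ne (hne a ha).symm]
      exact hsymm _ _ _ _ (key a ha)
    · rw [Function.update_of_ne (hne a ha).symm, Function.update_of_ne (hne b hb).symm]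
      exact hf a ha b hb hab

lemma card_filter_superset_le {X : Type*} [Fintype X] [DecidableEq X] (E : Finset X) (t : ℕ) :
    ((Finset.powersetCard t (univ : Finset X)).filter (E ⊆ ·)).card ≤
      Fintype.card X ^ (t - E.card) := by
  have h : ((Finset.powersetCard t (univ : Finset X)).filter (E ⊆ ·)).card ≤
      (Finset.powersetCard (t - E.card) (univ : Finset X)).card := by
    refine Finset.card_le_card_of_injOn (· \ E) ?_ ?_
    · intro d hd
      obtain ⟨hd, hE⟩ := Finset.mem_filter.1 hd
      refine Finset.mem_coe.2 (Finset.mem_powersetCard.2 ⟨Finset.subset_univ _, ?_⟩)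
      rw [Finset.card_sdiff_of_subset hE, (Finset.mem_powersetCard.1 hd).2]
    · intro d hd d' hd' h
      have hE := (Finset.mem_filter.1 hd).2
      have hE' := (Finset.mem_filter.1 hd').2
      rw [← Finset.sdiff_union_of_subset hE, ← Finset.sdiff_union_of_subset hE']
      exact congrArg (· ∪ E) h
  refine h.trans ?_
  rw [Finset.card_powersetCard, Finset.card_univ]
  exact Nat.choose_le_pow _ _

lemma sum_pow_card_inter_le {X : Type*} [Fintype X] [DecidableEq X] {C p t : ℕ} (hC : 1 ≤ C)
    (hX : Fintype.card X ≤ C * p) (d : Finset X) (hd : d.card = t) :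
    ∑ d' ∈ Finset.powersetCard t (univ : Finset X), p ^ (d ∩ d').card ≤
      2 ^ t * (C ^ t * p ^ t) := by
  calc ∑ d' ∈ Finset.powersetCard t (univ : Finset X), p ^ (d ∩ d').card
      ≤ ∑ d' ∈ Finset.powersetCard t (univ : Finset X),
          ∑ E ∈ d.powerset, if E ⊆ d' then p ^ E.card else 0 := by
        refine Finset.sum_le_sum fun d' _ => ?_
        have h := Finset.single_le_sum (f := fun E => if E ⊆ d' then p ^ E.card else 0)
          (fun _ _ => Nat.zero_le _) (Finset.mem_powerset.2 (Finset.inter_subset_left : d ∩ d' ⊆ d))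
        simpa [Finset.inter_subset_right] using h
    _ = ∑ E ∈ d.powerset, ((Finset.powersetCard t (univ : Finset X)).filter (E ⊆ ·)).card *
          p ^ E.card := by
        rw [Finset.sum_comm]
        refine Finset.sum_congr rfl fun E _ => ?_
        rw [← Finset.sum_filter, Finset.sum_const, smul_eq_mul]
    _ ≤ ∑ E ∈ d.powerset, C ^ t * p ^ t := by
        refine Finset.sum_le_sum fun E hE => ?_
        have hEt : E.card ≤ t := hd ▸ Finset.card_le_card (Finset.mem_powerset.1 hE)
        calc _ ≤ (C * p) ^ (t - E.card) * p ^ E.card :=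
              Nat.mul_le_mul_right _ ((card_filter_superset_le E t).trans
                (Nat.pow_le_pow_left hX _))
          _ = C ^ (t - E.card) * p ^ t := by
              rw [mul_pow, mul_assoc, ← pow_add, Nat.sub_add_cancel hEt]
          _ ≤ C ^ t * p ^ t :=
              Nat.mul_le_mul_right _ (Nat.pow_le_pow_right hC (Nat.sub_le _ _))
    _ = 2 ^ t * (C ^ t * p ^ t) := by
        rw [Finset.sum_const, Finset.card_powerset, hd, smul_eq_mul]

/-- Few words agree with a given word in at least `r` positions. -/
lemma exists_cover_agreeing_words {s p r : ℕ} (w' : Fin s → Fin p) :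
    ∃ T : Finset (Fin s → Fin p), T.card ≤ 2 ^ s * p ^ (s - r) ∧
      ∀ w, r ≤ (univ.filter fun τ => w τ = w' τ).card → w ∈ T := by
  classical
  refine ⟨(Finset.powersetCard r (univ : Finset (Fin s))).biUnion fun S =>
    Fintype.piFinset fun τ => if τ ∈ S then {w' τ} else univ, ?_, ?_⟩
  · refine (Finset.card_biUnion_le_card_mul _ _ (p ^ (s - r)) ?_).trans
      (Nat.mul_le_mul_right _ ?_)
    · intro S hS
      rw [Finset.mem_powersetCard] at hS
      have h : ∀ τ, (if τ ∈ S then {w' τ} else univ : Finset (Fin p)).card =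
          if τ ∈ S then 1 else p := by
        intro τ; split_ifs <;> simp
      rw [Fintype.card_piFinset, Finset.prod_congr rfl fun τ _ => h τ, Finset.prod_ite]
      simp [Finset.filter_not, Finset.card_sdiff, hS.2]
    · rw [Finset.card_powersetCard, Finset.card_univ, Fintype.card_fin]
      exact Nat.choose_le_two_pow _ _
  · intro w hw
    obtain ⟨S, hS, hr⟩ := Finset.exists_subset_card_eq hw
    refine Finset.mem_biUnion.2 ⟨S, Finset.mem_powersetCard.2 ⟨Finset.subset_univ _, hr⟩, ?_⟩
    refine Fintype.mem_piFinset.2 fun τ => ?_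
    split_ifs with h
    · exact Finset.mem_singleton.2 (Finset.mem_filter.1 (hS h)).2
    · exact Finset.mem_univ _

/-- Every `t`-subset of `X` can be given a word so that distinct sets with a large intersection
get words that agree in few positions. -/
lemma exists_word_assignment {X : Type*} [Fintype X] [DecidableEq X] {C p t s : ℕ} (hC : 1 ≤ C)
    (hX : Fintype.card X ≤ C * p) (hts : t + 1 ≤ s) (hp : 2 ^ s * (2 ^ t * C ^ t) < p) :
    ∃ w : Finset X → Fin s → Fin p, ∀ d d', d.card = t → d'.card = t → d ≠ d' →
      (d ∩ d').card + (univ.filter fun τ => w d τ = w d' τ).card ≤ t := by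
  have hp0 : 0 < p := by omega
  have : Nonempty (Fin p) := ⟨⟨0, hp0⟩⟩
  obtain ⟨w, hw⟩ := exists_greedy_assignment (ι := Finset X) (W := Fin s → Fin p)
    (fun d d' w w' => d.card = t → d'.card = t →
      (d ∩ d').card + (univ.filter fun τ => w τ = w' τ).card ≤ t)
    (fun d d' w w' h h1 h2 => by
      rw [Finset.inter_comm]
      simpa only [eq_comm] using h h2 h1)
    (fun d d' => 2 ^ s * p ^ (s - (t + 1 - (d ∩ d').card)))
    (fun d d' w' _ => by
      obtain ⟨T, hT, hT'⟩ := exists_cover_agreeing_words (r := t + 1 - (d ∩ d').card) w'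
      refine ⟨T, hT, fun w hw => hT' w ?_⟩
      push Not at hw
      omega)
    (Finset.powersetCard t univ) (fun d hd => by
      rw [Finset.mem_powersetCard] at hd
      have hsum := sum_pow_card_inter_le hC hX d hd.2
      have h1 : ∀ d' : Finset X, 2 ^ s * p ^ (s - (t + 1 - (d ∩ d').card)) =
          2 ^ s * p ^ (s - (t + 1)) * p ^ (d ∩ d').card := by
        intro d'
        have := Finset.card_le_card (Finset.inter_subset_left : d ∩ d' ⊆ d)
        rw [mul_assoc, ← pow_add]
        congr 2
        omega
      rw [Finset.sum_congr rfl fun d' _ => h1 d', ← Finset.mul_sum]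
      calc _ ≤ 2 ^ s * p ^ (s - (t + 1)) * (2 ^ t * (C ^ t * p ^ t)) := Nat.mul_le_mul_left _ hsum
        _ = 2 ^ s * (2 ^ t * C ^ t) * p ^ (s - (t + 1) + t) := by rw [pow_add]; ring
        _ < p * p ^ (s - (t + 1) + t) := Nat.mul_lt_mul_of_pos_right hp (pow_pos hp0 _)
        _ = Fintype.card (Fin s → Fin p) := by
          rw [← pow_succ', Fintype.card_fun, Fintype.card_fin, Fintype.card_fin]
          congr 1
          omega)
  refine ⟨w, fun d d' hd hd' hne => hw d ?_ d' ?_ hne hd hd'⟩ <;>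
    simp [Finset.mem_powersetCard, hd, hd']

/-- There are arbitrarily large ground sets carrying block systems for all small parameters. -/
lemma exists_isBlockSystem (Q : ℕ) :
    ∃ (X : Type) (_ : Fintype X) (_ : DecidableEq X), Q ≤ Fintype.card X ∧
      ∀ t s, t + 1 ≤ s → s ≤ Q → ∃ 𝓑 : Set (Finset X), IsBlockSystem t s 𝓑 := by
  classical
  obtain ⟨V, _, _, R, hR, hdom⟩ := exists_dominating_relation Q
  obtain ⟨v₀, -⟩ := hdom ∅ (by simp)
  have hV : 0 < Fintype.card V := Fintype.card_pos_iff.2 ⟨v₀⟩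
  obtain ⟨C, hC⟩ : ∃ C, C = Fintype.card V * (2 * Q) + 1 := ⟨_, rfl⟩
  obtain ⟨p, hp⟩ : ∃ p, p = 2 ^ Q * (2 ^ Q * C ^ Q) + 1 := ⟨_, rfl⟩
  have hX : Fintype.card (V × Bool × Fin Q × Fin p) = Fintype.card V * (2 * (Q * p)) := by
    simp
  refine ⟨V × Bool × Fin Q × Fin p, inferInstance, inferInstance, ?_, ?_⟩
  · rw [hX]
    nlinarith [Nat.mul_le_mul hV (Nat.mul_le_mul_left (2 * Q) (show 1 ≤ p by omega))]
  intro t s hts hsQ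
  have hC1 : 1 ≤ C := by omega
  obtain ⟨w, hw⟩ := exists_word_assignment (X := V × Bool × Fin Q × Fin p) (C := C) (p := p)
    hC1 (by rw [hX, hC]; nlinarith) hts (by
      rw [hp, Nat.lt_succ_iff]
      gcongr <;> omega)
  have hv : ∀ d : Finset (V × Bool × Fin Q × Fin p), d.card = t → ∃ v, ∀ x ∈ d, R v x.1 := by
    intro d hd
    obtain ⟨v, hv⟩ := hdom (d.image Prod.fst) (Finset.card_image_le.trans (by omega))
    exact ⟨v, fun x hx => hv _ (Finset.mem_image_of_mem _ hx)⟩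
  have : Nonempty V := ⟨v₀⟩
  choose! v hv using hv
  let g : Finset (V × Bool × Fin Q × Fin p) → Bool → Fin s → V × Bool × Fin Q × Fin p :=
    fun d b τ => (v d, b, Fin.castLE hsQ τ, w d τ)
  let N : Finset (V × Bool × Fin Q × Fin p) → Bool → Finset (V × Bool × Fin Q × Fin p) :=
    fun d b => univ.image (g d b)
  have hgi : ∀ d b, Function.Injective (g d b) := by
    intro d b τ τ' h
    exact (show τ = τ' ∧ w d τ = w d τ' by simpa [g] using h).1
  have hmem : ∀ d b x, x ∈ N d b → x.1 = v d ∧ x.2.1 = b := by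
    intro d b x hx
    obtain ⟨τ, -, rfl⟩ := Finset.mem_image.1 hx
    exact ⟨rfl, rfl⟩
  have hnot : ∀ d d' b, d.card = t → v d = v d' → ∀ x ∈ d, x ∉ N d' b := by
    intro d d' b hd hvv x hx hx'
    have h := hv d hd x hx
    rw [(hmem _ _ _ hx').1, ← hvv] at h
    exact hR _ _ h h
  have hinter : ∀ d d' b, d.card = t → d'.card = t → d ≠ d' →
      (d ∩ d').card + (N d b ∩ N d' b).card ≤ t := by
    intro d d' b hd hd' hne
    refine le_trans (Nat.add_le_add_left ?_ _) (hw d d' hd hd' hne)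
    refine le_trans (Finset.card_le_card (t := (univ.filter fun τ => w d τ = w d' τ).image (g d b))
      ?_) Finset.card_image_le
    intro x hx
    obtain ⟨h1, h2⟩ := Finset.mem_inter.1 hx
    obtain ⟨τ, -, rfl⟩ := Finset.mem_image.1 h1
    obtain ⟨τ', -, h⟩ := Finset.mem_image.1 h2
    simp only [g, Prod.mk.injEq, Fin.castLE_inj] at h
    obtain ⟨-, -, rfl, h⟩ := h
    exact Finset.mem_image_of_mem _ (Finset.mem_filter.2 ⟨Finset.mem_univ _, h.symm⟩)
  refine ⟨{B | ∃ d b, d.card = t ∧ B = d ∪ N d b}, ?_, ?_, ?_⟩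
  · rintro _ ⟨d, b, hd, rfl⟩
    rw [Finset.card_union_of_disjoint (Finset.disjoint_left.2 (hnot d d b hd rfl)), hd,
      Finset.card_image_of_injective _ (hgi d b), Finset.card_univ, Fintype.card_fin]
  · rintro _ ⟨d, b, hd, rfl⟩ _ ⟨d', b', hd', rfl⟩ hne
    by_cases hvv : v d = v d'
    · have hsub : (d ∪ N d b) ∩ (d' ∪ N d' b') ⊆ (d ∩ d') ∪ (N d b ∩ N d' b') := by
        intro x hx
        have h1 := hnot d d' b' hd hvv x
        have h2 := hnot d' d b hd' hvv.symm x
        simp only [Finset.mem_inter, Finset.mem_union] at hx ⊢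
        tauto
      refine (Finset.card_le_card hsub).trans ((Finset.card_union_le _ _).trans ?_)
      by_cases hb : b = b'
      · subst hb
        exact hinter d d' b hd hd' fun h => hne (h ▸ rfl)
      · have h0 : N d b ∩ N d' b' = ∅ := by
          refine Finset.eq_empty_of_forall_notMem fun x hx => hb ?_
          obtain ⟨h1, h2⟩ := Finset.mem_inter.1 hx
          rw [← (hmem _ _ _ h1).2, ← (hmem _ _ _ h2).2]
        rw [h0, Finset.card_empty, add_zero, ← hd]
        exact Finset.card_le_card Finset.inter_subset_left
    · have h0 : ∀ x ∈ N d b, x ∉ N d' b' := fun x h1 h2 =>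
        hvv ((hmem _ _ _ h1).1.symm.trans (hmem _ _ _ h2).1)
      by_cases h1 : ∃ x ∈ d, x ∈ N d' b'
      · obtain ⟨x, hx, hx'⟩ := h1
        have hr := hv d hd x hx
        rw [(hmem _ _ _ hx').1] at hr
        refine (Finset.card_le_card (t := d) ?_).trans hd.le
        intro y hy
        have h2 : y ∈ d' → y ∉ N d b := by
          intro hy1 hy2
          have hr' := hv d' hd' y hy1
          rw [(hmem _ _ _ hy2).1] at hr'
          exact hR _ _ hr hr'
        have h3 := h0 y
        simp only [Finset.mem_inter, Finset.mem_union] at hy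
        tauto
      · push Not at h1
        refine (Finset.card_le_card (t := d') ?_).trans hd'.le
        intro y hy
        have h2 := h0 y
        have h3 := h1 y
        simp only [Finset.mem_inter, Finset.mem_union] at hy
        tauto
  · intro d hd
    refine ⟨_, ⟨d, true, hd, rfl⟩, _, ⟨d, false, hd, rfl⟩, ?_, Finset.subset_union_left,
      Finset.subset_union_left⟩
    intro h
    have h1 : g d true ⟨0, by omega⟩ ∈ N d true := Finset.mem_image_of_mem _ (Finset.mem_univ _)
    have h2 : g d true ⟨0, by omega⟩ ∈ d ∪ N d false := h ▸ Finset.mem_union_right _ h1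
    rcases Finset.mem_union.1 h2 with h3 | h3
    · exact hnot d d true hd rfl _ h3 h1
    · exact Bool.noConfusion (hmem _ _ _ h3).2

/-- A stack of `k` gadgets, the `i`-th one realising a layer of size `n i` on the range of
cardinalities `[N i, N (i + 1))`. -/
structure LayeredSystem {X : Type} [Fintype X] [DecidableEq X] (k : ℕ) (n N : ℕ → ℕ)
    (L U : ℕ → Set (Finset X)) : Prop where
  pos : ∀ i < k, 1 ≤ n i
  cons : ∀ i, i + 1 < k → ¬ (n i = 1 ∧ n (i + 1) = 1)
  mono : Monotone N
  zero : N 0 = 0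
  top : N k = Fintype.card X + 1
  flat : ∀ i < k, n i = 1 → N (i + 1) = N i
  gadget : ∀ i < k, Gadget (n i) (N i) (N (i + 1)) (L i) (U i)

lemma exists_layeredSystem {k : ℕ} (hk : 2 ≤ k) {n : ℕ → ℕ} (pos : ∀ i < k, 1 ≤ n i)
    (cons : ∀ i, i + 1 < k → ¬ (n i = 1 ∧ n (i + 1) = 1)) :
    ∃ (X : Type) (_ : Fintype X) (_ : DecidableEq X) (N : ℕ → ℕ) (L U : ℕ → Set (Finset X)),
      LayeredSystem k n N L U := by
  obtain ⟨c₀, hc₀⟩ : ∃ c₀, ∀ i < k, n i ≤ c₀ :=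
    ⟨∑ i ∈ Finset.range k, n i, fun i hi =>
      Finset.single_le_sum (f := n) (fun _ _ => Nat.zero_le _) (Finset.mem_range.2 hi)⟩
  have hc₁ : 1 ≤ c₀ := (pos 0 (by omega)).trans (hc₀ 0 (by omega))
  obtain ⟨a, ha0, hastep⟩ : ∃ a : ℕ → ℕ, a 0 = 0 ∧
      ∀ i, a (i + 1) = if n i = 1 then a i else 3 * a i + (2 * c₀ + 2) :=
    ⟨fun i => Nat.rec 0 (fun i x => if n i = 1 then x else 3 * x + (2 * c₀ + 2)) i, rfl,
      fun _ => rfl⟩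
  have hamono : Monotone a := monotone_nat_of_le_succ fun i => by
    rw [hastep]; split_ifs <;> omega
  have haval : ∀ i, a i = 0 ∨ 2 * c₀ + 2 ≤ a i := by
    intro i
    induction i with
    | zero => exact Or.inl ha0
    | succ i ih => rw [hastep]; split_ifs <;> omega
  obtain ⟨X, _, _, hQ, hblock⟩ := exists_isBlockSystem (a k + 2 * c₀ + 2)
  obtain ⟨i₁, hi₁, hn₁, hlast⟩ : ∃ i₁ < k, 2 ≤ n i₁ ∧ ∀ i < k, i₁ < i → n i = 1 := by
    by_cases h : n (k - 1) = 1
    · have h1 := pos (k - 2) (by omega)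
      have h2 := cons (k - 2) (by omega)
      rw [show k - 2 + 1 = k - 1 by omega] at h2
      refine ⟨k - 2, by omega, by omega, fun i hi hi' => ?_⟩
      rw [show i = k - 1 by omega, h]
    · have h1 := pos (k - 1) (by omega)
      exact ⟨k - 1, by omega, by omega, fun i hi hi' => by omega⟩
  obtain ⟨N, hN⟩ : ∃ N : ℕ → ℕ, ∀ i, N i = if i ≤ i₁ then a i else Fintype.card X + 1 :=
    ⟨_, fun _ => rfl⟩
  have haX : ∀ i ≤ k, a i + 2 * c₀ + 2 ≤ Fintype.card X := fun i hi => by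
    have := hamono hi
    omega
  have hgadget : ∀ i, ∃ L U : Set (Finset X), i < k →
      Gadget (n i) (N i) (N (i + 1)) L U := by
    intro i
    by_cases hi : i < k
    swap
    · exact ⟨∅, ∅, fun h => (hi h).elim⟩
    have hX := haX i hi.le
    have hni := hc₀ i hi
    have hnpos := pos i hi
    rcases lt_trichotomy i i₁ with h | h | h
    · have e1 : N i = a i := by rw [hN, if_pos h.le]
      have e2 : N (i + 1) = a (i + 1) := by rw [hN, if_pos (by omega)]
      rw [e1, e2, hastep]
      split_ifs with h1
      · rw [h1]
        exact ⟨_, _, fun _ => gadget_one (by omega)⟩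
      · by_cases h0 : a i = 0
        · rw [h0]
          exact ⟨_, _, fun _ => gadget_bottom (by omega) (by omega)⟩
        · by_cases h3 : 3 ≤ n i
          · exact ⟨_, _, fun _ => gadget_three h3 (by omega) (by omega)⟩
          · have hv := haval i
            have hik := hamono hi.le
            obtain ⟨𝓑, h𝓑⟩ := hblock (a i - 1) (a i + 1 + c₀) (by omega) (by omega)
            have hg := gadget_two h𝓑 (by omega) (by omega) (by omega)
            rw [show a i - 1 + 1 = a i by omega,
              show a i - 1 + 2 * (a i + 1 + c₀) + 1 = 3 * a i + (2 * c₀ + 2) by omega] at hg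
            rw [show n i = 2 by omega]
            exact ⟨_, _, fun _ => hg⟩
    · subst h
      have e1 : N i = a i := by rw [hN, if_pos le_rfl]
      have e2 : N (i + 1) = Fintype.card X + 1 := by rw [hN, if_neg (by omega)]
      rw [e1, e2]
      exact ⟨_, _, fun _ => gadget_top hn₁ (by omega)⟩
    · have e1 : N i = Fintype.card X + 1 := by rw [hN, if_neg (by omega)]
      have e2 : N (i + 1) = Fintype.card X + 1 := by rw [hN, if_neg (by omega)]
      rw [e1, e2, hlast i hi h]
      exact ⟨_, _, fun _ => gadget_one le_rfl⟩
  choose L U hLU using hgadget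
  refine ⟨X, _, _, N, L, U, pos, cons, monotone_nat_of_le_succ fun i => ?_, ?_, ?_, ?_, hLU⟩
  · rw [hN, hN]
    have h1 := hamono (Nat.le_succ i)
    split_ifs with h2 h3
    · exact h1
    · have := haX i (by omega)
      omega
    · omega
    · exact le_rfl
  · rw [hN, if_pos (Nat.zero_le _), ha0]
  · rw [hN, if_neg (by omega)]
  · intro i hi h1
    have hne : i ≠ i₁ := by rintro rfl; omega
    rw [hN, hN]
    by_cases h : i < i₁
    · rw [if_pos (by omega), if_pos h.le, hastep, if_pos h1]
    · rw [if_neg (by omega), if_neg (by omega)]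

namespace LayeredSystem

variable {X : Type} [Fintype X] [DecidableEq X] {k : ℕ} {n N : ℕ → ℕ} {L U : ℕ → Set (Finset X)}

lemma exists_zone (h : LayeredSystem k n N L U) (z : Finset X) :
    ∃ i < k, N i ≤ z.card ∧ z.card < N (i + 1) := by
  have hz : z.card < N k := by rw [h.top]; exact Nat.lt_succ_of_le (Finset.card_le_univ z)
  have hex : ∃ i, z.card < N i := ⟨k, hz⟩
  classical
  obtain ⟨i, hi⟩ : ∃ i, Nat.find hex = i + 1 := by
    refine Nat.exists_eq_succ_of_ne_zero fun h0 => ?_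
    have := Nat.find_spec hex
    rw [h0, h.zero] at this
    omega
  have h1 := Nat.find_spec hex
  have h2 := Nat.find_min' hex hz
  rw [hi] at h1 h2
  exact ⟨i, h2, not_lt.1 (Nat.find_min hex (by omega)), h1⟩

lemma exists_lower_layers (h : LayeredSystem k n N L U) : ∀ i ≤ k, ∀ z : Finset X, N i ≤ z.card →
    ∃ f : ∀ j, Fin (n j) → Finset X, (∀ j < i, ∀ a, f j a ∈ L j ∧ f j a ⊆ z) ∧
      (∀ j < i, ∀ a b, a ≠ b → ¬ f j a ⊆ f j b) ∧
      (∀ j' < i, ∀ j < j', ∀ a b, f j a ⊆ f j' b) := by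
  intro i
  induction i with
  | zero => exact fun _ _ _ => ⟨fun _ _ => ∅, by simp, by simp, by simp⟩
  | succ i ih =>
    intro hi z hz
    obtain ⟨g, d, hg, hanti, hd⟩ := (h.gadget i hi).down z hz
    obtain ⟨f, hf, hfa, hfm⟩ := ih (by omega) d hd
    obtain ⟨a₀⟩ : Nonempty (Fin (n i)) := ⟨⟨0, h.pos i hi⟩⟩
    have hdz : d ⊆ z := (hg a₀).2.2.trans (hg a₀).2.1
    refine ⟨Function.update f i g, fun j hj => ?_, fun j hj => ?_, fun j' hj' j hj => ?_⟩
    · rcases Nat.lt_succ_iff_lt_or_eq.1 hj with hj | rfl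
      · rw [Function.update_of_ne hj.ne]
        exact fun a => ⟨(hf j hj a).1, (hf j hj a).2.trans hdz⟩
      · rw [Function.update_self]
        exact fun a => ⟨(hg a).1, (hg a).2.1⟩
    · rcases Nat.lt_succ_iff_lt_or_eq.1 hj with hj | rfl
      · rw [Function.update_of_ne hj.ne]
        exact hfa j hj
      · rw [Function.update_self]
        exact hanti
    · rw [Function.update_of_ne (by omega : j ≠ i)]
      rcases Nat.lt_succ_iff_lt_or_eq.1 hj' with hj' | rfl
      · rw [Function.update_of_ne hj'.ne]
        exact hfm j' hj' j hj
      · rw [Function.update_self]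
        exact fun a b => (hf j hj a).2.trans (hg b).2.2

lemma exists_upper_layers (h : LayeredSystem k n N L U) : ∀ i ≤ k, ∀ z : Finset X, z.card < N i →
    ∃ f : ∀ j, Fin (n j) → Finset X, (∀ j < k, i ≤ j → ∀ a, f j a ∈ U j ∧ z ⊆ f j a) ∧
      (∀ j < k, i ≤ j → ∀ a b, a ≠ b → ¬ f j a ⊆ f j b) ∧
      (∀ j' < k, ∀ j < j', i ≤ j → ∀ a b, f j a ⊆ f j' b) := by
  intro i hi
  induction hi using Nat.decreasingInduction with
  | self =>
    exact fun _ _ => ⟨fun _ _ => ∅, by intros; omega, by intros; omega, by intros; omega⟩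
  | of_succ i hi ih =>
    intro z hz
    obtain ⟨g, w, hg, hanti, hw⟩ := (h.gadget i hi).up z hz
    obtain ⟨f, hf, hfa, hfm⟩ := ih w hw
    obtain ⟨a₀⟩ : Nonempty (Fin (n i)) := ⟨⟨0, h.pos i hi⟩⟩
    have hzw : z ⊆ w := (hg a₀).2.1.trans (hg a₀).2.2
    refine ⟨Function.update f i g, fun j hj hij => ?_, fun j hj hij => ?_,
      fun j' hj' j hj hij => ?_⟩
    · rcases hij.eq_or_lt with rfl | hij
      · rw [Function.update_self]
        exact fun a => ⟨(hg a).1, (hg a).2.1⟩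
      · rw [Function.update_of_ne hij.ne']
        exact fun a => ⟨(hf j hj hij a).1, hzw.trans (hf j hj hij a).2⟩
    · rcases hij.eq_or_lt with rfl | hij
      · rw [Function.update_self]
        exact hanti
      · rw [Function.update_of_ne hij.ne']
        exact hfa j hj hij
    · rw [Function.update_of_ne (by omega : j' ≠ i)]
      rcases hij.eq_or_lt with rfl | hij
      · rw [Function.update_self]
        exact fun a b => (hg a).2.2.trans (hf j' hj' hj b).2
      · rw [Function.update_of_ne hij.ne']
        exact hfm j' hj' j hj hij

/-- A hypothetical copy of the layered poset in the family built from the system, with each set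
replaced by its trace on `X`; `low` marks the sets coming from the lower families. -/
structure IsTrace (k : ℕ) (n : ℕ → ℕ) (L U : ℕ → Set (Finset X))
    (π : ∀ i, Fin (n i) → Finset X) (low : ∀ i, Fin (n i) → Prop) : Prop where
  mem_low : ∀ i < k, ∀ a, low i a → ∃ j < k, π i a ∈ L j
  mem_up : ∀ i < k, ∀ a, ¬ low i a → ∃ j < k, π i a ∈ U j
  anti : ∀ i < k, ∀ a b, a ≠ b → ¬ (π i a ⊆ π i b ∧ (low i a ∨ ¬ low i b))
  le : ∀ j < k, ∀ i < j, ∀ a b, π i a ⊆ π j b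

variable {π : ∀ i, Fin (n i) → Finset X} {low : ∀ i, Fin (n i) → Prop}

lemma le_card_of_trace (h : LayeredSystem k n N L U) (ht : IsTrace k n L U π low) {i : ℕ}
    (hi : i < k) {d w : Finset X} (hd : ∀ a, d ⊆ π i a) (hw : ∀ a, π i a ⊆ w)
    (hdi : N i ≤ d.card) : N (i + 1) ≤ w.card := by
  have hpos := h.pos i hi
  by_cases h1 : n i = 1
  · rw [h.flat i hi h1]
    exact hdi.trans (Finset.card_le_card ((hd ⟨0, hpos⟩).trans (hw _)))
  by_contra! hlt
  have : Nontrivial (Fin (n i)) := Fin.nontrivial_iff_two_le.2 (by omega)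
  have hidx : ∀ j, N i < N (j + 1) → N j < N (i + 1) → j = i := by
    intro j hij hji
    have h1 := h.mono.reflect_lt hij
    have h2 := h.mono.reflect_lt hji
    omega
  refine absurd ((h.gadget i hi).free (π i) (low i) d w ?_ ?_ (ht.anti i hi) hd hw hdi) (by omega)
  · intro a ha
    obtain ⟨j, hj, hmem⟩ := ht.mem_low i hi a ha
    obtain ⟨b, hb⟩ := exists_ne a
    have hne : d ≠ π i a := fun he => ht.anti i hi a b hb.symm ⟨he ▸ hd b, Or.inl ha⟩
    have hc1 := Finset.card_lt_card ((hd a).ssubset_of_ne hne)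
    have hc2 := Finset.card_le_card (hw a)
    have hs := (h.gadget j hj).low_size _ hmem
    have hji := hidx j (by omega) (by omega)
    subst hji
    exact hmem
  · intro a ha
    obtain ⟨j, hj, hmem⟩ := ht.mem_up i hi a ha
    obtain ⟨b, hb⟩ := exists_ne a
    have hne : π i a ≠ w := fun he => ht.anti i hi b a hb ⟨he ▸ hw b, Or.inr ha⟩
    have hc1 := Finset.card_lt_card ((hw a).ssubset_of_ne hne)
    have hc2 := Finset.card_le_card (hd a)
    have hs := (h.gadget j hj).up_size _ hmem
    have hji := hidx j (by omega) (by omega)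
    subst hji
    exact hmem

lemma le_card_of_forall_subset (h : LayeredSystem k n N L U) (ht : IsTrace k n L U π low) :
    ∀ i ≤ k, ∀ w : Finset X, (∀ j < i, ∀ a, π j a ⊆ w) → N i ≤ w.card := by
  intro i
  induction i with
  | zero => intro _ w _; rw [h.zero]; exact Nat.zero_le _
  | succ i ih =>
    intro hi w hw
    have hd : ∀ a, univ.inf (π i) ⊆ π i a := fun a => Finset.inf_le (Finset.mem_univ a)
    refine h.le_card_of_trace ht hi hd (hw i (by omega)) (ih (by omega) _ fun j hj a => ?_)
    exact Finset.le_inf fun b _ => ht.le i hi j hj a b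

lemma not_isTrace (h : LayeredSystem k n N L U) : ¬ IsTrace k n L U π low := by
  intro ht
  have h1 := h.le_card_of_forall_subset ht k le_rfl univ fun _ _ _ => Finset.subset_univ _
  rw [h.top, Finset.card_univ] at h1
  omega

end LayeredSystem

/-- A copy of the layered poset amounts to a choice of antichains, each lying below the next
ones; strictness between distinct layers is automatic when no two consecutive layers are
singletons. -/
lemma containsCopy_iff {k m : ℕ} {n : ℕ → ℕ} (pos : ∀ i < k, 1 ≤ n i)
    (cons : ∀ i, i + 1 < k → ¬ (n i = 1 ∧ n (i + 1) = 1)) (𝒜 : Finset (Finset (Fin m))) :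
    ContainsCopy (KPoset fun i : Fin k => n i) 𝒜 ↔
      ∃ h : ∀ i, Fin (n i) → Finset (Fin m), (∀ i < k, ∀ a, h i a ∈ 𝒜) ∧
        (∀ i < k, ∀ a b, a ≠ b → ¬ h i a ⊆ h i b) ∧
        (∀ j < k, ∀ i < j, ∀ a b, h i a ⊆ h j b) := by
  constructor
  · rintro ⟨f, -, hmem, hle⟩
    have hval : ∀ i (hi : i < k) (a : Fin (n i)),
        (if hi : i < k then f ⟨⟨i, hi⟩, a⟩ else ∅) = f ⟨⟨i, hi⟩, a⟩ := fun i hi a => dif_pos hi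
    refine ⟨fun i a => if hi : i < k then f ⟨⟨i, hi⟩, a⟩ else ∅, fun i hi a => ?_,
      fun i hi a b hab => ?_, fun j hj i hij a b => ?_⟩
    · simp only [hval i hi]
      exact hmem _
    · simp only [hval i hi]
      intro hsub
      rcases (hle _ _).2 hsub with h | h
      · exact hab (eq_of_heq (Sigma.mk.inj h).2)
      · exact lt_irrefl _ h
    · simp only [hval i (hij.trans hj), hval j hj]
      exact (hle _ _).1 (Or.inr hij)
  · rintro ⟨h, hmem, hanti, hle⟩
    have hone : ∀ i < k, ∀ a : Fin (n i), (∀ b, b ≠ a → False) → n i = 1 := by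
      intro i hi a h1
      by_contra hne
      have := pos i hi
      have : Nontrivial (Fin (n i)) := Fin.nontrivial_iff_two_le.2 (by omega)
      obtain ⟨b, hb⟩ := exists_ne a
      exact h1 b hb
    have hstrict : ∀ j < k, ∀ i < j, ∀ a b, ¬ h j b ⊆ h i a := by
      intro j hj i hij a b hba
      have hi1 : n i = 1 := hone i (by omega) a fun a' ha' =>
        hanti i (by omega) a' a ha' ((hle j hj i hij a' b).trans hba)
      refine cons i (by omega) ⟨hi1, ?_⟩
      by_cases hs : j = i + 1
      · subst hs
        exact hone (i + 1) hj b fun b' hb' =>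
          hanti (i + 1) hj b b' hb'.symm (hba.trans (hle (i + 1) hj i hij a b'))
      · refine hone (i + 1) (by omega) ⟨0, pos _ (by omega)⟩ fun c hc =>
          hanti (i + 1) (by omega) _ _ hc ?_
        exact ((hle j hj (i + 1) (by omega) c b).trans hba).trans
          (hle (i + 1) (by omega) i (by omega) a _)
    have hiff : ∀ x y : KPoset fun i : Fin k => n i, x ≤ y ↔ h x.1 x.2 ⊆ h y.1 y.2 := by
      rintro ⟨⟨i, hi⟩, a⟩ ⟨⟨j, hj⟩, b⟩
      constructor
      · rintro (h1 | h1)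
        · rw [h1]
        · exact hle j hj i h1 a b
      · intro hsub
        change h i a ⊆ h j b at hsub
        rcases lt_trichotomy i j with hij | hij | hij
        · exact Or.inr hij
        · subst hij
          by_cases hab : a = b
          · exact Or.inl (hab ▸ rfl)
          · exact (hanti i hi a b hab hsub).elim
        · exact (hstrict i hi j hij b a hsub).elim
    refine ⟨fun x => h x.1 x.2, fun x y hxy => ?_, fun x => hmem _ x.1.2 _, hiff⟩
    exact le_antisymm ((hiff x y).2 hxy.subset) ((hiff y x).2 hxy.symm.subset)

section Seed

variable {X : Type} [Fintype X] {k m : ℕ} {n N : ℕ → ℕ}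
  {L U : ℕ → Set (Finset X)}

/-- The seed family: lower sets are copied into `Fin m` along `e`, and upper sets are enlarged by
all points outside the range of `e`. -/
def IsSeed (e : X ↪ Fin m) (k : ℕ) (L U : ℕ → Set (Finset X)) (S : Finset (Fin m)) : Prop :=
  (∃ j < k, ∃ l ∈ L j, S = l.map e) ∨ ∃ j < k, ∃ u ∈ U j, S = u.map e ∪ (univ.map e)ᶜ

/-- The trace on `X` of a subset of `Fin m`. -/
def trace (e : X ↪ Fin m) (S : Finset (Fin m)) : Finset X := univ.filter fun x => e x ∈ S

lemma mem_trace {e : X ↪ Fin m} {S : Finset (Fin m)} {x : X} : x ∈ trace e S ↔ e x ∈ S := by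
  simp [trace]

lemma trace_map (e : X ↪ Fin m) (l : Finset X) : trace e (l.map e) = l := by
  ext x; simp [mem_trace]

lemma trace_map_union (e : X ↪ Fin m) (u : Finset X) :
    trace e (u.map e ∪ (univ.map e)ᶜ) = u := by
  ext x; simp [mem_trace]

lemma map_trace_subset (e : X ↪ Fin m) (S : Finset (Fin m)) : (trace e S).map e ⊆ S := by
  intro y hy
  obtain ⟨x, hx, rfl⟩ := Finset.mem_map.1 hy
  exact mem_trace.1 hx

lemma subset_map_trace_union (e : X ↪ Fin m) (S : Finset (Fin m)) :
    S ⊆ (trace e S).map e ∪ (univ.map e)ᶜ := by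
  intro y hy
  by_cases h : y ∈ univ.map e
  · obtain ⟨x, -, rfl⟩ := Finset.mem_map.1 h
    exact Finset.mem_union_left _ (Finset.mem_map_of_mem _ (mem_trace.2 hy))
  · exact Finset.mem_union_right _ (Finset.mem_compl.2 h)

variable [DecidableEq X]

lemma not_containsCopy_seed (h : LayeredSystem k n N L U) (e : X ↪ Fin m)
    (hm : Fintype.card X < m) (𝒜 : Finset (Finset (Fin m))) (h𝒜 : ∀ S ∈ 𝒜, IsSeed e k L U S) :
    ¬ ContainsCopy (KPoset fun i : Fin k => n i) 𝒜 := by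
  rw [containsCopy_iff h.pos h.cons]
  rintro ⟨f, hmem, hanti, hle⟩
  obtain ⟨y, -, hy⟩ : ∃ y ∈ (univ : Finset (Fin m)), y ∉ univ.map e :=
    Finset.exists_mem_notMem_of_card_lt_card (by simpa using hm)
  refine h.not_isTrace (π := fun i a => trace e (f i a)) (low := fun i a => f i a ⊆ univ.map e)
    ⟨fun i hi a ha => ?_, fun i hi a ha => ?_, fun i hi a b hab => ?_, fun j hj i hij a b => ?_⟩
  · rcases h𝒜 _ (hmem i hi a) with ⟨j, hj, l, hl, hS⟩ | ⟨j, hj, u, hu, hS⟩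
    · refine ⟨j, hj, ?_⟩
      rwa [hS, trace_map]
    · rw [hS] at ha
      exact (hy (ha (Finset.mem_union_right _ (Finset.mem_compl.2 hy)))).elim
  · rcases h𝒜 _ (hmem i hi a) with ⟨j, hj, l, hl, hS⟩ | ⟨j, hj, u, hu, hS⟩
    · rw [hS] at ha
      exact (ha (Finset.map_subset_map.2 (Finset.subset_univ l))).elim
    · refine ⟨j, hj, ?_⟩
      rwa [hS, trace_map_union]
  · rintro ⟨hsub, hlow⟩
    refine hanti i hi a b hab fun x hx => ?_
    rcases Finset.mem_union.1 (subset_map_trace_union e _ hx) with hx' | hx'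
    · exact map_trace_subset e _ (Finset.map_subset_map.2 hsub hx')
    · rcases hlow with hlow | hlow
      · exact (Finset.mem_compl.1 hx' (hlow hx)).elim
      · rcases h𝒜 _ (hmem i hi b) with ⟨j, hj, l, hl, hS⟩ | ⟨j, hj, u, hu, hS⟩
        · rw [hS] at hlow
          exact (hlow (Finset.map_subset_map.2 (Finset.subset_univ l))).elim
        · rw [hS]
          exact Finset.mem_union_right _ hx'
  · intro x hx
    exact mem_trace.2 (hle j hj i hij a b (mem_trace.1 hx))

/-- In a copy-free family containing the seed, sets with a common trace `z` do not contain an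
antichain of the size prescribed by the zone of `z`. -/
lemma false_of_antichain (h : LayeredSystem k n N L U) (e : X ↪ Fin m)
    {𝒜 : Finset (Finset (Fin m))} (h𝒜 : ∀ S, IsSeed e k L U S → S ∈ 𝒜)
    (hfree : ¬ ContainsCopy (KPoset fun i : Fin k => n i) 𝒜) {i : ℕ} (hi : i < k) {z : Finset X}
    (h1 : N i ≤ z.card) (h2 : z.card < N (i + 1)) (g : Fin (n i) → Finset (Fin m))
    (hg : ∀ a, g a ∈ 𝒜) (hz : ∀ a, trace e (g a) = z) (hanti : ∀ a b, a ≠ b → ¬ g a ⊆ g b) :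
    False := by
  obtain ⟨p, hp, hpa, hpm⟩ := h.exists_lower_layers i hi.le z h1
  obtain ⟨q, hq, hqa, hqm⟩ := h.exists_upper_layers (i + 1) hi z h2
  have hzg : ∀ a, z.map e ⊆ g a := fun a => hz a ▸ map_trace_subset e (g a)
  have hgz : ∀ a, g a ⊆ z.map e ∪ (univ.map e)ᶜ := fun a => hz a ▸ subset_map_trace_union e (g a)
  obtain ⟨f₀, hf₀⟩ : ∃ f₀ : ∀ j, Fin (n j) → Finset (Fin m),
      ∀ j a, f₀ j a = if j < i then (p j a).map e else (q j a).map e ∪ (univ.map e)ᶜ :=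
    ⟨_, fun _ _ => rfl⟩
  have hlo : ∀ j < i, ∀ a, Function.update f₀ i g j a = (p j a).map e := fun j hj a => by
    rw [Function.update_of_ne hj.ne, hf₀, if_pos hj]
  have hhi : ∀ j, i < j → ∀ a, Function.update f₀ i g j a = (q j a).map e ∪ (univ.map e)ᶜ :=
    fun j hj a => by rw [Function.update_of_ne hj.ne', hf₀, if_neg hj.not_gt]
  refine hfree ((containsCopy_iff h.pos h.cons 𝒜).2 ⟨Function.update f₀ i g, ?_, ?_, ?_⟩)
  · intro j hj a
    rcases lt_trichotomy j i with hji | rfl | hji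
    · rw [hlo j hji]
      exact h𝒜 _ (Or.inl ⟨j, hj, _, (hp j hji a).1, rfl⟩)
    · rw [Function.update_self]
      exact hg a
    · rw [hhi j hji]
      exact h𝒜 _ (Or.inr ⟨j, hj, _, (hq j hj hji a).1, rfl⟩)
  · intro j hj a b hab hsub
    rcases lt_trichotomy j i with hji | rfl | hji
    · rw [hlo j hji, hlo j hji] at hsub
      exact hpa j hji a b hab (Finset.map_subset_map.1 hsub)
    · rw [Function.update_self] at hsub
      exact hanti a b hab hsub
    · rw [hhi j hji, hhi j hji] at hsub
      refine hqa j hj hji a b hab fun x hx => ?_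
      rw [← trace_map_union e (q j b), mem_trace]
      exact hsub (Finset.mem_union_left _ (Finset.mem_map_of_mem _ hx))
  · intro j hj j' hj' a b
    rcases lt_trichotomy j i with hji | rfl | hji
    · rw [hlo j hji, hlo j' (hj'.trans hji)]
      exact Finset.map_subset_map.2 (hpm j hji j' hj' a b)
    · rw [hlo j' hj', Function.update_self]
      exact (Finset.map_subset_map.2 (hp j' hj' a).2).trans (hzg b)
    · rw [hhi j hji]
      have hzq : z.map e ∪ (univ.map e)ᶜ ⊆ (q j b).map e ∪ (univ.map e)ᶜ :=
        Finset.union_subset_union_left (Finset.map_subset_map.2 (hq j hj hji b).2)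
      rcases lt_trichotomy j' i with hji' | rfl | hji'
      · rw [hlo j' hji']
        exact ((Finset.map_subset_map.2 (hp j' hji' a).2).trans Finset.subset_union_left).trans hzq
      · rw [Function.update_self]
        exact (hgz a).trans hzq
      · rw [hhi j' hji']
        exact Finset.union_subset_union_left (Finset.map_subset_map.2 (hqm j hj j' hj' hji' a b))

lemma card_le_of_not_containsCopy (h : LayeredSystem k n N L U) (e : X ↪ Fin m) {c : ℕ}
    (hc : ∀ i < k, n i ≤ c) {𝒜 : Finset (Finset (Fin m))} (h𝒜 : ∀ S, IsSeed e k L U S → S ∈ 𝒜)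
    (hfree : ¬ ContainsCopy (KPoset fun i : Fin k => n i) 𝒜) :
    𝒜.card ≤ c * (2 ^ Fintype.card X * (m + 1)) := by
  have hlt : ∀ S : Finset (Fin m), S.card < m + 1 := fun S =>
    Nat.lt_succ_of_le (card_finset_fin_le S)
  refine (Finset.card_le_mul_card_image (f := fun S => (trace e S, (⟨S.card, hlt S⟩ : Fin (m + 1))))
    𝒜 c ?_).trans (Nat.mul_le_mul_left _ ?_)
  · rintro ⟨z, r⟩ -
    by_contra! hgt
    obtain ⟨i, hi, h1, h2⟩ := h.exists_zone z
    obtain ⟨T, hT, hTc⟩ := Finset.exists_subset_card_eq ((hc i hi).trans hgt.le)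
    let g := (T.equivFinOfCardEq hTc).symm
    have hmem : ∀ a, (g a : Finset (Fin m)) ∈ 𝒜 ∧ trace e (g a) = z ∧
        (g a : Finset (Fin m)).card = r := by
      intro a
      obtain ⟨hm1, hm2⟩ := Finset.mem_filter.1 (hT (g a).2)
      rw [Prod.mk.injEq] at hm2
      exact ⟨hm1, hm2.1, congrArg Fin.val hm2.2⟩
    refine false_of_antichain h e h𝒜 hfree hi h1 h2 (fun a => g a) (fun a => (hmem a).1)
      (fun a => (hmem a).2.1) fun a b hab hsub => hab (g.injective (Subtype.ext ?_))
    exact Finset.eq_of_subset_of_card_le hsub ((hmem b).2.2.trans (hmem a).2.2.symm).le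
  · refine (Finset.card_le_univ _).trans ?_
    simp

lemma satStar_le (h : LayeredSystem k n N L U) (hm : Fintype.card X < m) {c : ℕ}
    (hc : ∀ i < k, n i ≤ c) :
    satStar (KPoset fun i : Fin k => n i) m ≤ c * (2 ^ Fintype.card X * (m + 1)) := by
  classical
  obtain ⟨e⟩ : Nonempty (X ↪ Fin m) :=
    Function.Embedding.nonempty_of_card_le (by simpa using hm.le)
  obtain ⟨𝒜, h0, hmax⟩ := Finite.exists_le_maximal
    (p := fun 𝒜 : Finset (Finset (Fin m)) => ¬ ContainsCopy (KPoset fun i : Fin k => n i) 𝒜)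
    (not_containsCopy_seed h e hm (univ.filter (IsSeed e k L U)) fun S hS =>
      (Finset.mem_filter.1 hS).2)
  refine le_trans (Nat.sInf_le ⟨𝒜, ⟨hmax.prop, fun S hS => ?_⟩, rfl⟩)
    (card_le_of_not_containsCopy h e hc (fun S hS => h0 (by simpa using hS)) hmax.prop)
  by_contra hS'
  exact hS (hmax.le_of_ge hS' (Finset.subset_insert _ _) (Finset.mem_insert_self _ _))

end Seed

/-- If `k ≥ 2` and `n₁, …, n_k` are positive integers with no two
consecutive layers of size 1, then `sat*(n, K_{n₁,…,n_k}) = O(n)`: there is a constant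
`C` (depending only on the layer sizes) with `sat*(n, K_{n₁,…,n_k}) ≤ C * n` for all
sufficiently large `n`. -/
theorem statement13 (k : ℕ) (hk : 2 ≤ k) (ns : Fin k → ℕ) (hns : ∀ i, 1 ≤ ns i)
    (hcons : ∀ (i : ℕ) (hi : i + 1 < k),
      ¬ (ns ⟨i, Nat.lt_of_succ_lt hi⟩ = 1 ∧ ns ⟨i + 1, hi⟩ = 1)) :
    ∃ C N : ℕ, ∀ n ≥ N, satStar (KPoset ns) n ≤ C * n := by
  obtain ⟨n, rfl⟩ : ∃ n : ℕ → ℕ, ns = fun i : Fin k => n i :=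
    ⟨fun i => if hi : i < k then ns ⟨i, hi⟩ else 1, by funext i; simp⟩
  obtain ⟨X, _, _, N, L, U, h⟩ := exists_layeredSystem hk (fun i hi => hns ⟨i, hi⟩) hcons
  refine ⟨(∑ i ∈ Finset.range k, n i) * 2 ^ Fintype.card X * 2, Fintype.card X + 1,
    fun m hm => ?_⟩
  refine (satStar_le h (Nat.lt_of_succ_le hm) fun i hi => Finset.single_le_sum (f := n)
    (fun _ _ => Nat.zero_le _) (Finset.mem_range.2 hi)).trans ?_
  rw [← mul_assoc, mul_assoc _ 2 m]
  exact Nat.mul_le_mul_left _ (by omega)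
end
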